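/- For any integer r ≥ 4 and any β > 0 there exist α > 0 and n₀ ∈ ℕ such that every (α, β, p, r)-neat graph with n vertices, where n > n₀, n is divisible by r, and p ≥ n^{-1/3}, contains a K_r-factor. -/

import Mathlib

/-!
Statement 8 (Lemma 4.2): for any integer `r ≥ 4` and any `β > 0` there exist `α > 0` and
`n₀ ∈ ℕ` such that every `(α, β, p, r)`-neat graph with `n > n₀` vertices, `r ∣ n` and
`p ≥ n^(-1/3)` contains a `K_r`-factor.
-/

open Finset
open scoped Classical

/-- Property (P3): for all disjoint `V₁, …, V_{r+1} ⊆ V(G)` each of size at least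
`n^(1-β)`, there is a copy of `K_{r+1}⁻` (the complete graph on `r+1` vertices minus one
edge) with one vertex in each `V_i`. -/
def PropP3 {n : ℕ} (G : SimpleGraph (Fin n)) (β : ℝ) (r : ℕ) : Prop :=
  ∀ V : Fin (r + 1) → Finset (Fin n),
    (∀ i j : Fin (r + 1), i ≠ j → Disjoint (V i) (V j)) →
    (∀ i : Fin (r + 1), (n : ℝ) ^ ((1 : ℝ) - β) ≤ ((V i).card : ℝ)) →
    ∃ f : Fin (r + 1) → Fin n, Function.Injective f ∧ (∀ i, f i ∈ V i) ∧
      ∃ a b : Fin (r + 1), a ≠ b ∧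
        ∀ i j : Fin (r + 1), i ≠ j → ¬(i = a ∧ j = b) → ¬(i = b ∧ j = a) →
          G.Adj (f i) (f j)

/-- A graph `G` on `n` vertices is `(α, β, p, r)`-neat. -/
def Neat {n : ℕ} (G : SimpleGraph (Fin n)) (α β p : ℝ) (r : ℕ) : Prop :=
  -- (P1)
  ((∀ v : Fin n, (n : ℝ) * p / 2 ≤ ((G.neighborFinset v).card : ℝ)) ∧
    ∀ X Y : Finset (Fin n), Disjoint X Y →
      Real.log (n : ℝ) / p ≤ (X.card : ℝ) → α * (n : ℝ) ≤ (Y.card : ℝ) →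
      ∃ v ∈ X, (Y.card : ℝ) * p / 2 ≤ (((Y.filter (G.Adj v)).card : ℝ))) ∧
  -- (P2)
  (∀ v : Fin n, ∀ X ⊆ G.neighborFinset v, α * (n : ℝ) * p ≤ (X.card : ℝ) →
    ∃ S ⊆ X, G.IsNClique (r - 1) S) ∧
  -- (P3)
  PropP3 G β r

/-- The subgraph of `G` induced by the vertex set `U` can be perfectly covered by pairwise
vertex-disjoint copies of `K_r` (i.e. it contains a `K_r`-factor). -/
def HasKrFactorOn {V : Type} [DecidableEq V] (G : SimpleGraph V) (r : ℕ)
    (U : Finset V) : Prop :=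
  ∃ P : Finset (Finset V),
    (∀ S ∈ P, G.IsNClique r S) ∧
    (∀ S ∈ P, ∀ T ∈ P, S ≠ T → Disjoint S T) ∧
    P.biUnion id = U

section Factors

variable {V : Type} [DecidableEq V] {G : SimpleGraph V} {r : ℕ}

lemma hasKrFactorOn_empty : HasKrFactorOn G r ∅ := ⟨∅, by simp, by simp, by simp⟩

lemma HasKrFactorOn.union {A B : Finset V} (hA : HasKrFactorOn G r A) (hB : HasKrFactorOn G r B)
    (hAB : Disjoint A B) : HasKrFactorOn G r (A ∪ B) := by
  obtain ⟨P, hP1, hP2, rfl⟩ := hA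
  obtain ⟨Q, hQ1, hQ2, rfl⟩ := hB
  have key : ∀ S ∈ P, ∀ T ∈ Q, Disjoint S T := fun S hS T hT =>
    hAB.mono (subset_biUnion_of_mem id hS) (subset_biUnion_of_mem id hT)
  refine ⟨P ∪ Q, ?_, ?_, ?_⟩
  · intro S hS
    rcases mem_union.1 hS with h | h
    exacts [hP1 S h, hQ1 S h]
  · intro S hS T hT hne
    rcases mem_union.1 hS with h | h <;> rcases mem_union.1 hT with h' | h'
    exacts [hP2 S h T h' hne, key S h T h', (key T h' S h).symm, hQ2 S h T h' hne]
  · rw [union_biUnion]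

lemma HasKrFactorOn.of_isNClique {S : Finset V} (hS : G.IsNClique r S) : HasKrFactorOn G r S :=
  ⟨{S}, by simpa using hS, by simp, by simp⟩

lemma HasKrFactorOn.biUnion {ι : Type*} [DecidableEq ι] (s : Finset ι) (D : ι → Finset V)
    (hD : ∀ i ∈ s, HasKrFactorOn G r (D i)) (hdisj : ∀ i ∈ s, ∀ j ∈ s, i ≠ j → Disjoint (D i) (D j)) :
    HasKrFactorOn G r (s.biUnion D) := by
  induction s using Finset.induction_on with
  | empty => simpa using hasKrFactorOn_empty
  | insert a s ha ih =>
    rw [biUnion_insert]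
    refine (hD a (mem_insert_self a s)).union
      (ih (fun i hi => hD i (mem_insert_of_mem hi))
        fun i hi j hj => hdisj i (mem_insert_of_mem hi) j (mem_insert_of_mem hj)) ?_
    rw [disjoint_biUnion_right]
    intro i hi
    exact hdisj a (mem_insert_self a s) i (mem_insert_of_mem hi) (by rintro rfl; exact ha hi)

lemma HasKrFactorOn.dvd_card {A : Finset V} (hA : HasKrFactorOn G r A) : r ∣ #A := by
  obtain ⟨P, hP1, hP2, rfl⟩ := hA
  rw [card_biUnion (t := id) (fun S hS T hT h => hP2 S hS T hT h)]
  exact Finset.dvd_sum fun S hS => by simp [(hP1 S hS).card_eq]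

/-- `D` contains `u` and `v`, and deleting either of them leaves a set with a `K_r`-factor. -/
def IsSwitch (G : SimpleGraph V) (r : ℕ) (D : Finset V) (u v : V) : Prop :=
  u ∈ D ∧ v ∈ D ∧ HasKrFactorOn G r (D.erase u) ∧ HasKrFactorOn G r (D.erase v)

lemma IsSwitch.refl (u : V) : IsSwitch G r {u} u u := by
  simp [IsSwitch, hasKrFactorOn_empty]

lemma IsSwitch.symm {D : Finset V} {u v : V} (h : IsSwitch G r D u v) : IsSwitch G r D v u :=
  ⟨h.2.1, h.1, h.2.2.2, h.2.2.1⟩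

lemma HasKrFactorOn.erase_union {D D' : Finset V} {u v : V} (hD : HasKrFactorOn G r (D.erase u))
    (hD' : HasKrFactorOn G r (D'.erase v)) (hu : u ∈ D) (hv : v ∈ D) (h : D ∩ D' = {v}) :
    HasKrFactorOn G r ((D ∪ D').erase u) := by
  have h1 : ∀ x, x ∈ D → x ∈ D' → x = v := fun x hx hx' => by
    have : x ∈ D ∩ D' := mem_inter.2 ⟨hx, hx'⟩
    simpa [h] using this
  have hv' : v ∈ D' := by
    have : v ∈ D ∩ D' := by simp [h]
    exact (mem_inter.1 this).2
  have : (D ∪ D').erase u = D.erase u ∪ D'.erase v := by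
    ext x
    simp only [mem_erase, mem_union]
    by_cases hx : x = v
    · subst hx; tauto
    · by_cases hxu : x = u
      · subst hxu
        have := h1 x hu
        tauto
      · tauto
  rw [this]
  refine hD.union hD' ?_
  rw [disjoint_left]
  intro x hx hx'
  exact (mem_erase.1 hx').1 (h1 x (mem_erase.1 hx).2 (mem_erase.1 hx').2)

lemma IsSwitch.trans {D D' : Finset V} {u v w : V} (hD : IsSwitch G r D u v)
    (hD' : IsSwitch G r D' v w) (h : D ∩ D' = {v}) : IsSwitch G r (D ∪ D') u w := by
  refine ⟨mem_union_left _ hD.1, mem_union_right _ hD'.2.1,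
    hD.2.2.1.erase_union hD'.2.2.1 hD.1 hD.2.1 h, ?_⟩
  rw [union_comm]
  exact hD'.2.2.2.erase_union hD.2.2.2 hD'.2.1 hD'.1 (by rw [inter_comm, h])

end Factors

/-- Pairwise non-conflicting representatives can be chosen greedily from large sets. -/
lemma exists_nonconflicting {V ι : Type*} [DecidableEq V] [DecidableEq ι] [Nonempty V]
    (R : V → V → Prop) (hR : ∀ x y, R x y → R y x) (s : Finset ι) (L : ι → Finset V)
    (U : Finset V) (Δ : ℕ) (hL : ∀ i ∈ s, L i ⊆ U) (hΔ : ∀ x ∈ U, #(U.filter (R x)) ≤ Δ)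
    (hcard : ∀ i ∈ s, #s * Δ < #(L i)) :
    ∃ f : ι → V, (∀ i ∈ s, f i ∈ L i) ∧ ∀ i ∈ s, ∀ j ∈ s, i ≠ j → ¬ R (f i) (f j) := by
  induction s using Finset.induction_on with
  | empty => exact ⟨fun _ => Classical.arbitrary V, by simp, by simp⟩
  | insert a s ha ih =>
    obtain ⟨f, hf1, hf2⟩ := ih (fun i hi => hL i (mem_insert_of_mem hi)) (fun i hi =>
      lt_of_le_of_lt (Nat.mul_le_mul_right _ (card_le_card (subset_insert a s)))
        (hcard i (mem_insert_of_mem hi)))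
    have hlt : #(s.biUnion fun i => U.filter (R (f i))) < #(L a) := by
      calc #(s.biUnion fun i => U.filter (R (f i))) ≤ #s * Δ :=
            card_biUnion_le_card_mul _ _ _ fun i hi =>
              hΔ _ (hL i (mem_insert_of_mem hi) (hf1 i hi))
        _ ≤ #(insert a s) * Δ := Nat.mul_le_mul_right _ (card_le_card (subset_insert a s))
        _ < #(L a) := hcard a (mem_insert_self a s)
    obtain ⟨x, hxL, hx⟩ := exists_mem_notMem_of_card_lt_card hlt
    have hxR : ∀ i ∈ s, ¬ R (f i) x := fun i hi h => hx (mem_biUnion.2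
      ⟨i, hi, mem_filter.2 ⟨hL a (mem_insert_self a s) hxL, h⟩⟩)
    have hne : ∀ i ∈ s, i ≠ a := by rintro i hi rfl; exact ha hi
    refine ⟨Function.update f a x, ?_, ?_⟩
    · intro i hi
      rcases mem_insert.1 hi with rfl | hi
      · simpa using hxL
      · rw [Function.update_of_ne (hne i hi)]; exact hf1 i hi
    · intro i hi j hj hij
      rcases mem_insert.1 hi with hi | hi <;> rcases mem_insert.1 hj with hj | hj
      · exact absurd (hi.trans hj.symm) hij
      · rw [hi, Function.update_self, Function.update_of_ne (hne j hj)]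
        exact fun h => hxR j hj (hR _ _ h)
      · rw [hj, Function.update_self, Function.update_of_ne (hne i hi)]
        exact hxR i hi
      · rw [Function.update_of_ne (hne i hi), Function.update_of_ne (hne j hj)]
        exact hf2 i hi j hj hij

/-- Among any `r + 1` disjoint sets of size at least `m` there is a transversal on which
deleting either of some two vertices leaves a copy of `K_r`. -/
def SwitchProp {V : Type} [DecidableEq V] (G : SimpleGraph V) (r m : ℕ) : Prop :=
  ∀ Z : Fin (r + 1) → Finset V, (∀ i j, i ≠ j → Disjoint (Z i) (Z j)) → (∀ i, m ≤ #(Z i)) →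
    ∃ i j, i ≠ j ∧ ∃ a ∈ Z i, ∃ b ∈ Z j, ∃ E ⊆ univ.biUnion Z, a ∈ E ∧ b ∈ E ∧ #E = r + 1 ∧
      G.IsNClique r (E.erase a) ∧ G.IsNClique r (E.erase b)

lemma isNClique_image_erase {V : Type} [DecidableEq V] {G : SimpleGraph V} {r : ℕ}
    {f : Fin (r + 1) → V} (hf : Function.Injective f) {a b : Fin (r + 1)}
    (h : ∀ i j : Fin (r + 1), i ≠ j → ¬(i = a ∧ j = b) → ¬(i = b ∧ j = a) →
      G.Adj (f i) (f j)) : G.IsNClique r ((univ.image f).erase (f a)) := by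
  refine ⟨?_, ?_⟩
  · intro x hx y hy hxy
    simp only [coe_erase, coe_image, coe_univ, Set.image_univ, Set.mem_sdiff, Set.mem_range,
      Set.mem_singleton_iff] at hx hy
    obtain ⟨⟨i, rfl⟩, hi⟩ := hx
    obtain ⟨⟨j, rfl⟩, hj⟩ := hy
    exact h i j (fun e => hxy (by rw [e])) (fun e => hi (by rw [e.1])) (fun e => hj (by rw [e.2]))
  · rw [card_erase_of_mem (mem_image_of_mem _ (mem_univ _)), card_image_of_injective _ hf]
    simp

lemma PropP3.switchProp {n : ℕ} {G : SimpleGraph (Fin n)} {β : ℝ} {r m : ℕ} (h : PropP3 G β r)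
    (hm : (n : ℝ) ^ ((1 : ℝ) - β) ≤ m) : SwitchProp G r m := by
  intro Z hZ hcard
  obtain ⟨f, hf, hfZ, a, b, hab, hadj⟩ := h Z hZ fun i => hm.trans (by exact_mod_cast hcard i)
  refine ⟨a, b, hab, f a, hfZ a, f b, hfZ b, univ.image f, ?_, mem_image_of_mem _ (mem_univ _),
    mem_image_of_mem _ (mem_univ _), by rw [card_image_of_injective _ hf]; simp,
    isNClique_image_erase hf hadj,
    isNClique_image_erase hf fun i j hij h1 h2 => hadj i j hij h2 h1⟩
  intro x hx
  obtain ⟨i, -, rfl⟩ := mem_image.1 hx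
  exact mem_biUnion.2 ⟨i, mem_univ _, hfZ i⟩

/-- A version of `SwitchProp` in which each vertex `v` carries a bounded set `F v` of vertices
which the switch must avoid if it ends in `v`. -/
lemma SwitchProp.exists_avoiding {V : Type} [DecidableEq V] {G : SimpleGraph V} {r m : ℕ}
    (h : SwitchProp G r m) (Z : Fin (r + 1) → Finset V)
    (hZ : ∀ i j, i ≠ j → Disjoint (Z i) (Z j)) {N C : ℕ} (hcard : ∀ i, #(Z i) = N)
    (F : V → Finset V) (hF : ∀ v, #(F v) ≤ C)
    (hN : 2 * ((r + 1) * m * (1 + C + 2 * C * (r + 1))) < N) :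
    ∃ i j, i ≠ j ∧ ∃ a ∈ Z i, ∃ b ∈ Z j, ∃ E ⊆ univ.biUnion Z, IsSwitch G r E a b ∧
      #E = r + 1 ∧ Disjoint (E.erase a) (F a) ∧ Disjoint (E.erase b) (F b) := by
  classical
  set U := univ.biUnion Z with hU
  have hUcard : #U = (r + 1) * N := by
    rw [hU, card_biUnion (fun i _ j _ hij => hZ i j hij)]; simp [hcard]
  set D := C * (r + 1) with hD
  set ind : V → ℕ := fun x => #(U.filter fun y => x ∈ F y) with hind
  have hsum : ∑ x ∈ U, ind x ≤ (r + 1) * N * C := by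
    calc ∑ x ∈ U, ind x = ∑ x ∈ U, ∑ y ∈ U, if x ∈ F y then 1 else 0 := by
          refine sum_congr rfl fun x _ => ?_
          rw [hind]; simp only [card_filter]
      _ = ∑ y ∈ U, ∑ x ∈ U, if x ∈ F y then 1 else 0 := sum_comm
      _ ≤ ∑ y ∈ U, C := by
          refine sum_le_sum fun y _ => ?_
          rw [← card_filter]
          refine (card_le_card ?_).trans (hF y)
          intro x hx; exact (mem_filter.1 hx).2
      _ = (r + 1) * N * C := by rw [sum_const, hUcard, smul_eq_mul]
  set L : Fin (r + 1) → Finset V := fun i => (Z i).filter fun x => ind x ≤ 2 * C * (r + 1) with hL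
  have hZU : ∀ i, Z i ⊆ U := fun i => subset_biUnion_of_mem Z (mem_univ i)
  have hLcard : ∀ i, N ≤ 2 * #(L i) := by
    intro i
    have h1 : #((Z i).filter fun x => ¬ ind x ≤ 2 * C * (r + 1)) * (2 * C * (r + 1) + 1)
        ≤ (r + 1) * N * C := by
      refine le_trans ?_ hsum
      rw [← smul_eq_mul]
      refine (card_nsmul_le_sum _ ind _ ?_).trans
        (sum_le_sum_of_subset ((filter_subset _ _).trans (hZU i)))
      intro x hx
      have := (mem_filter.1 hx).2
      omega
    have h2 := card_filter_add_card_filter_not (s := Z i) (fun x => ind x ≤ 2 * C * (r + 1))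
    rw [hcard i] at h2
    by_contra hcon
    have h3 : N < 2 * #((Z i).filter fun x => ¬ ind x ≤ 2 * C * (r + 1)) := by
      simp only [hL] at hcon
      omega
    set q := #((Z i).filter fun x => ¬ ind x ≤ 2 * C * (r + 1))
    have : (r + 1) * N * C ≤ (2 * q) * (C * (r + 1)) := by
      calc (r + 1) * N * C = N * (C * (r + 1)) := by ring
        _ ≤ _ := Nat.mul_le_mul_right _ h3.le
    have h4 : 0 < q := by omega
    nlinarith
  set R : V → V → Prop := fun x y => x = y ∨ x ∈ F y ∨ y ∈ F x with hR
  set U' := univ.biUnion L with hU'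
  have hU'U : U' ⊆ U := biUnion_mono fun i _ => filter_subset _ _
  have : Nonempty V := by
    have : 0 < #(Z 0) := by rw [hcard 0]; omega
    exact ⟨(card_pos.1 this).choose⟩
  obtain ⟨f, hf1, hf2⟩ := exists_nonconflicting R (by
      rintro x y (h | h | h)
      exacts [Or.inl h.symm, Or.inr (Or.inr h), Or.inr (Or.inl h)])
    (univ : Finset (Fin (r + 1) × Fin m)) (fun p => L p.1) U' (1 + C + 2 * C * (r + 1))
    (fun p _ => subset_biUnion_of_mem L (mem_univ p.1)) (by
      intro x hx
      obtain ⟨i, -, hi⟩ := mem_biUnion.1 hx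
      have hi2 : ind x ≤ 2 * C * (r + 1) := (mem_filter.1 hi).2
      have : U'.filter (R x) ⊆ ({x} ∪ F x) ∪ U.filter fun y => x ∈ F y := by
        intro y hy
        obtain ⟨hy1, rfl | hy2 | hy2⟩ := mem_filter.1 hy
        · simp
        · simp [hU'U hy1, hy2]
        · simp [hy2]
      refine le_trans (le_of_eq (by congr)) ((card_le_card this).trans ((card_union_le _ _).trans ?_))
      refine Nat.add_le_add ((card_union_le _ _).trans ?_) hi2
      simpa using hF x) (by
      intro p _
      have := hLcard p.1
      simp only [card_univ, Fintype.card_prod, Fintype.card_fin]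
      omega)
  have hfinj : Function.Injective f := by
    intro p q hpq
    by_contra hne
    exact hf2 p (mem_univ _) q (mem_univ _) hne (Or.inl hpq)
  set X : Fin (r + 1) → Finset V := fun i => univ.image fun q : Fin m => f (i, q) with hX
  have hXZ : ∀ i, X i ⊆ Z i := by
    intro i x hx
    obtain ⟨q, -, rfl⟩ := mem_image.1 hx
    exact (mem_filter.1 (hf1 (i, q) (mem_univ _))).1
  obtain ⟨i, j, hij, a, ha, b, hb, E, hE, haE, hbE, hEc, h1, h2⟩ := h X
    (fun i j hij => (hZ i j hij).mono (hXZ i) (hXZ j)) (fun i => by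
      rw [hX]
      simp only
      rw [card_image_of_injective _ (fun q q' hq => by simpa using hfinj hq)]
      simp)
  have hEf : ∀ x ∈ E, ∃ p, f p = x := by
    intro x hx
    obtain ⟨k, -, hk⟩ := mem_biUnion.1 (hE hx)
    obtain ⟨q, -, rfl⟩ := mem_image.1 hk
    exact ⟨_, rfl⟩
  have hnc : ∀ x ∈ E, Disjoint (E.erase x) (F x) := by
    intro x hx
    rw [disjoint_left]
    intro y hy hyF
    obtain ⟨hne, hyE⟩ := mem_erase.1 hy
    obtain ⟨p, rfl⟩ := hEf x hx
    obtain ⟨q, rfl⟩ := hEf y hyE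
    exact hf2 q (mem_univ _) p (mem_univ _) (fun e => hne (by rw [e])) (Or.inr (Or.inl hyF))
  exact ⟨i, j, hij, a, hXZ i ha, b, hXZ j hb, E, hE.trans (biUnion_mono fun i _ => hXZ i),
    ⟨haE, hbE, .of_isNClique h1, .of_isNClique h2⟩, hEc, hnc a haE, hnc b hbE⟩
lemma SwitchProp.exists_avoiding_of_forall {V : Type} [DecidableEq V] {G : SimpleGraph V}
    {r m : ℕ} (h : SwitchProp G r m) (Z : Fin (r + 1) → Finset V)
    (hZ : ∀ i j, i ≠ j → Disjoint (Z i) (Z j)) {N C : ℕ} (hcard : ∀ i, #(Z i) = N)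
    (hN : 2 * ((r + 1) * m * (1 + C + 2 * C * (r + 1))) < N)
    {P : Fin (r + 1) → V → Finset V → Prop}
    (hP : ∀ i, ∀ a ∈ Z i, ∃ F, #F ≤ C ∧ P i a F) :
    ∃ i j, i ≠ j ∧ ∃ a ∈ Z i, ∃ b ∈ Z j, ∃ E ⊆ univ.biUnion Z, IsSwitch G r E a b ∧
      #E = r + 1 ∧ ∃ Fa Fb, P i a Fa ∧ P j b Fb ∧ #Fa ≤ C ∧ #Fb ≤ C ∧
        Disjoint (E.erase a) Fa ∧ Disjoint (E.erase b) Fb := by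
  have hex : ∀ a, ∃ F, #F ≤ C ∧ ∀ i, a ∈ Z i → P i a F := by
    intro a
    by_cases ha : ∃ i, a ∈ Z i
    · obtain ⟨i, hi⟩ := ha
      obtain ⟨F, hF1, hF2⟩ := hP i a hi
      refine ⟨F, hF1, fun j hj => ?_⟩
      by_cases hij : i = j
      · exact hij ▸ hF2
      · exact absurd hj (disjoint_left.1 (hZ i j hij) hi)
    · exact ⟨∅, by simp, fun i hi => absurd ⟨i, hi⟩ ha⟩
  choose F hF1 hF2 using hex
  obtain ⟨i, j, hij, a, ha, b, hb, E, hE, hs, hc, h1, h2⟩ :=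
    h.exists_avoiding Z hZ hcard F hF1 hN
  exact ⟨i, j, hij, a, ha, b, hb, E, hE, hs, hc, F a, F b, hF2 a i ha, hF2 b j hb, hF1 a, hF1 b,
    h1, h2⟩

lemma exists_small_subset_biUnion {ι V : Type*} [DecidableEq ι] [DecidableEq V]
    (A : ι → Finset V) (s N t : ℕ) (ht : 1 ≤ t) (U : Finset ι) (hU : #U ≤ t * s)
    (hN : t * N ≤ #(U.biUnion A)) : ∃ U' ⊆ U, #U' ≤ s ∧ N ≤ #(U'.biUnion A) := by
  induction t, ht using Nat.le_induction generalizing U with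
  | base => exact ⟨U, subset_rfl, by simpa using hU, by simpa using hN⟩
  | succ t ht ih =>
    obtain ⟨U', hU', hU'c⟩ := exists_subset_card_eq (min_le_right s #U)
    by_cases hN' : N ≤ #(U'.biUnion A)
    · exact ⟨U', hU', hU'c.trans_le (min_le_left _ _), hN'⟩
    · have h1 : #(U \ U') ≤ t * s := by
        rw [card_sdiff_of_subset hU', hU'c]
        rw [add_mul, one_mul] at hU
        rcases min_cases s #U with h | h <;> omega
      have h2 : #(U.biUnion A) ≤ #((U \ U').biUnion A) + #(U'.biUnion A) := by
        rw [← sdiff_union_of_subset hU', union_biUnion, sdiff_union_of_subset hU']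
        exact card_union_le _ _
      rw [add_mul, one_mul] at hN
      obtain ⟨U'', h3, h4⟩ := ih (U \ U') h1 (by omega)
      exact ⟨U'', h3.trans sdiff_subset, h4⟩

/-- If the sets `R J u` are small, then the growth of the sets `R j u` has to stop at some level. -/
lemma exists_level {ι V : Type*} [DecidableEq ι] [DecidableEq V] (R : ℕ → ι → Finset V)
    (X : Finset V) (U₀ : Finset ι) (N t J : ℕ) (ht : 1 ≤ t) (hN : 0 < N) (hU₀ : #U₀ ≤ t ^ J)
    (h0 : N ≤ #(U₀.biUnion (R 0) \ X)) (hJ : ∀ u ∈ U₀, #(R J u) < N) :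
    ∃ j < J, ∃ U ⊆ U₀, N ≤ #(U.biUnion (R j) \ X) ∧ #(U.biUnion (R (j + 1)) \ X) < t * N := by
  have hsd : ∀ j (U : Finset ι), U.biUnion (R j) \ X = U.biUnion fun u => R j u \ X := by
    intro j U; ext x; simp only [mem_sdiff, mem_biUnion]; tauto
  by_contra! hcon
  have key : ∀ j ≤ J, ∃ U ⊆ U₀, #U ≤ t ^ (J - j) ∧ N ≤ #(U.biUnion (R j) \ X) := by
    intro j
    induction j with
    | zero => exact fun _ => ⟨U₀, subset_rfl, hU₀, h0⟩
    | succ j ih =>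
      intro hj
      obtain ⟨U, hU, hUc, hUN⟩ := ih (by omega)
      have h1 := hcon j (by omega) U hU hUN
      rw [hsd] at h1
      have h2 : J - j = (J - (j + 1)) + 1 := by omega
      rw [h2, pow_succ'] at hUc
      obtain ⟨U', hU', h3, h4⟩ := exists_small_subset_biUnion _ _ N t ht U hUc h1
      exact ⟨U', hU'.trans hU, h3, by rwa [hsd]⟩
  obtain ⟨U, hU, hUc, hUN⟩ := key J le_rfl
  rw [Nat.sub_self, pow_zero] at hUc
  rcases U.eq_empty_or_nonempty with rfl | ⟨u, hu⟩
  · simp at hUN; omega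
  · have : U = {u} := eq_of_subset_of_card_le (by
      intro x hx; simpa using (card_le_one.1 hUc x hx u hu)) (by simp; exact ⟨u, hu⟩)
    rw [this, singleton_biUnion] at hUN
    have := hJ u (hU hu)
    have := card_le_card (sdiff_subset (s := R J u) (t := X))
    omega

section Reach

variable {V : Type} [DecidableEq V]

/-- There is a switch between `u` and `v` of size at most `c` avoiding `W`. -/
def Reach (G : SimpleGraph V) (r c : ℕ) (W : Finset V) (u v : V) : Prop :=
  ∃ D, IsSwitch G r D u v ∧ #D ≤ c ∧ Disjoint D W

variable {G : SimpleGraph V} {r : ℕ}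

lemma Reach.mono {c c' : ℕ} {W W' : Finset V} {u v : V} (h : Reach G r c W u v) (hc : c ≤ c')
    (hW : W' ⊆ W) : Reach G r c' W' u v := by
  obtain ⟨D, h1, h2, h3⟩ := h
  exact ⟨D, h1, h2.trans hc, h3.mono_right hW⟩

lemma IsSwitch.extend {D E : Finset V} {u a b : V} (hD : IsSwitch G r D u a)
    (hE : IsSwitch G r E a b) (hDE : Disjoint (E.erase a) D) :
    IsSwitch G r (D ∪ E) u b := by
  refine hD.trans hE ?_
  ext x
  simp only [mem_inter, mem_singleton]
  refine ⟨fun hx => ?_, ?_⟩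
  · by_contra hxa
    exact disjoint_left.1 hDE (mem_erase.2 ⟨hxa, hx.2⟩) hx.1
  · rintro rfl; exact ⟨hD.2.1, hE.1⟩

lemma card_union_le_of_erase {D E : Finset V} {a : V} (haD : a ∈ D) (haE : a ∈ E) :
    #(D ∪ E) + 1 ≤ #D + #E := by
  have h := card_union_add_card_inter D E
  have : 0 < #(D ∩ E) := card_pos.2 ⟨a, mem_inter.2 ⟨haD, haE⟩⟩
  omega

variable [Fintype V]

/-- Robustly, at least `N` vertices are reachable from `u` outside `W`. -/
def Expanding (G : SimpleGraph V) (r N c K : ℕ) (W : Finset V) (u : V) : Prop :=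
  ∀ W', #W' ≤ K → u ∉ W' → N ≤ #(univ.filter fun v => Reach G r c (W ∪ W') u v)

/-- All but few vertices are expanding. -/
lemma SwitchProp.card_not_expanding_lt {m : ℕ} (h : SwitchProp G r m) (W : Finset V)
    {N K J t : ℕ} (ht : 1 ≤ t) (hJ : N ≤ t ^ J)
    (hN : 2 * ((r + 1) * m * (1 + (1 + J * r + K) + 2 * (1 + J * r + K) * (r + 1))) < N) :
    #(univ.filter fun u => u ∉ W ∧ ¬ Expanding G r N (1 + J * r) K W u)
      < N + (r + 1) * (t * N) := by
  by_contra! hcon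
  set C := 1 + J * r + K with hC
  set Bad := univ.filter fun u => u ∉ W ∧ ¬ Expanding G r N (1 + J * r) K W u with hBad
  have hW' : ∀ u, ∃ W', u ∈ Bad → #W' ≤ K ∧ u ∉ W' ∧
      #(univ.filter fun v => Reach G r (1 + J * r) (W ∪ W') u v) < N := by
    intro u
    by_cases hu : u ∈ Bad
    · have := (mem_filter.1 hu).2.2
      simp only [Expanding] at this
      push Not at this
      obtain ⟨W', hw⟩ := this
      exact ⟨W', fun _ => hw⟩
    · exact ⟨∅, fun h => absurd h hu⟩
  choose Wu hWu using hW'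
  set R : ℕ → V → Finset V :=
    fun j u => univ.filter fun v => Reach G r (1 + j * r) (W ∪ Wu u) u v with hR
  have block : ∀ X : Finset V, ∃ Z Rcl : Finset V, #X ≤ r * (t * N) → #Z = N ∧ Disjoint Z X ∧
      Disjoint Z W ∧ Z ⊆ Rcl ∧ #(Rcl \ X) ≤ t * N ∧ ∀ a ∈ Z, ∃ F : Finset V, #F ≤ C ∧
        ∀ E b, IsSwitch G r E a b → #E = r + 1 → Disjoint (E.erase a) F → Disjoint E W →
          b ∈ Rcl := by
    intro X
    by_cases hX : #X ≤ r * (t * N)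
    swap
    · exact ⟨∅, ∅, fun h => absurd h hX⟩
    have h1 : N ≤ #(Bad \ X) := by
      have := le_card_sdiff X Bad
      have h2 : (r + 1) * (t * N) = r * (t * N) + t * N := by ring
      omega
    obtain ⟨U₀, hU₀, hU₀c⟩ := exists_subset_card_eq h1
    obtain ⟨j, hj, U, hU, hUN, hUt⟩ := exists_level R X U₀ N t J ht (by omega) (hU₀c.trans_le hJ)
      (by
        rw [← hU₀c]
        refine card_le_card fun u hu => ?_
        have hu' := mem_sdiff.1 (hU₀ hu)
        refine mem_sdiff.2 ⟨mem_biUnion.2 ⟨u, hu, ?_⟩, hu'.2⟩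
        refine mem_filter.2 ⟨mem_univ _, {u}, IsSwitch.refl u, by simp, ?_⟩
        rw [disjoint_singleton_left, mem_union]
        have h3 := (mem_filter.1 hu'.1).2.1
        have h4 := (hWu u hu'.1).2.1
        tauto)
      (fun u hu => (hWu u (mem_sdiff.1 (hU₀ hu)).1).2.2)
    obtain ⟨Z, hZ, hZc⟩ := exists_subset_card_eq hUN
    refine ⟨Z, U.biUnion (R (j + 1)), fun _ => ⟨hZc, ?_, ?_, ?_, hUt.le, ?_⟩⟩
    · exact disjoint_of_subset_left hZ sdiff_disjoint
    · rw [disjoint_left]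
      intro a ha haW
      obtain ⟨u, hu, hau⟩ := mem_biUnion.1 (mem_sdiff.1 (hZ ha)).1
      obtain ⟨D, hD1, hD2, hD3⟩ := (mem_filter.1 hau).2
      exact disjoint_left.1 hD3 hD1.2.1 (mem_union_left _ haW)
    · intro a ha
      obtain ⟨u, hu, hau⟩ := mem_biUnion.1 (mem_sdiff.1 (hZ ha)).1
      refine mem_biUnion.2 ⟨u, hu, mem_filter.2 ⟨mem_univ _, ?_⟩⟩
      exact (mem_filter.1 hau).2.mono (by gcongr; omega) subset_rfl
    · intro a ha
      obtain ⟨u, hu, hau⟩ := mem_biUnion.1 (mem_sdiff.1 (hZ ha)).1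
      obtain ⟨D, hD1, hD2, hD3⟩ := (mem_filter.1 hau).2
      have hWuK := (hWu u (mem_sdiff.1 (hU₀ (hU hu))).1).1
      have hjr : j * r ≤ J * r := Nat.mul_le_mul_right _ hj.le
      refine ⟨D ∪ Wu u, (card_union_le _ _).trans (by omega), ?_⟩
      intro E b hE hEc hEF hEW
      rw [disjoint_union_right] at hEF
      refine mem_biUnion.2 ⟨u, hu, mem_filter.2 ⟨mem_univ _, D ∪ E,
        hD1.extend hE hEF.1, ?_, ?_⟩⟩
      · have := card_union_le_of_erase hD1.2.1 hE.1
        rw [add_mul, one_mul]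
        omega
      · rw [disjoint_union_left]
        refine ⟨hD3, disjoint_union_right.2 ⟨hEW, ?_⟩⟩
        rw [disjoint_left]
        intro x hx hxW
        by_cases hxa : x = a
        · subst hxa
          exact disjoint_left.1 hD3 hD1.2.1 (mem_union_right _ hxW)
        · exact disjoint_left.1 hEF.2 (mem_erase.2 ⟨hxa, hx⟩) hxW
  choose Zf Rf hZR using block
  let X : ℕ → Finset V := fun i => Nat.rec ∅ (fun _ Y => Y ∪ Rf Y) i
  have hXs : ∀ i, X (i + 1) = X i ∪ Rf (X i) := fun _ => rfl
  have hXmono : Monotone X := monotone_nat_of_le_succ fun i => by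
    rw [hXs]; exact subset_union_left
  have hXc : ∀ i ≤ r, #(X i) ≤ i * (t * N) := by
    intro i
    induction i with
    | zero => intro _; simp [X]
    | succ i ih =>
      intro hi
      have h1 := ih (by omega)
      have h2 := (hZR (X i) (h1.trans (Nat.mul_le_mul_right _ (by omega)))).2.2.2.2.1
      rw [hXs, ← union_sdiff_self_eq_union, add_mul, one_mul]
      exact (card_union_le _ _).trans (Nat.add_le_add h1 h2)
  have hXr : ∀ i : Fin (r + 1), #(X i) ≤ r * (t * N) := fun i =>
    (hXc i (by omega)).trans (Nat.mul_le_mul_right _ (by omega))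
  have hlt : ∀ i j : Fin (r + 1), i < j → Rf (X i) ⊆ X j := fun i j hij =>
    (subset_union_right.trans (hXs i).symm.subset).trans (hXmono (Nat.succ_le_of_lt hij))
  have hZlt : ∀ i j : Fin (r + 1), i < j → Disjoint (Zf (X i)) (Zf (X j)) := fun i j hij =>
    ((hZR _ (hXr j)).2.1.mono_right (((hZR _ (hXr i)).2.2.2.1).trans (hlt i j hij))).symm
  obtain ⟨i, j, hij, a, ha, b, hb, E, hE, hs, hc, Fa, Fb, hFa, hFb, -, -, h1, h2⟩ :=
    h.exists_avoiding_of_forall (fun i : Fin (r + 1) => Zf (X i)) (fun i j hij => by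
      rcases lt_or_gt_of_ne hij with h | h
      exacts [hZlt i j h, (hZlt j i h).symm]) (fun i => (hZR _ (hXr i)).1) hN
      (P := fun i a F => ∀ E b, IsSwitch G r E a b → #E = r + 1 → Disjoint (E.erase a) F →
        Disjoint E W → b ∈ Rf (X i)) (fun i a ha => (hZR _ (hXr i)).2.2.2.2.2 a ha)
  have hEW : Disjoint E W := disjoint_of_subset_left hE (by
    rw [disjoint_biUnion_left]
    exact fun i _ => (hZR _ (hXr i)).2.2.1)
  rcases lt_or_gt_of_ne hij with hl | hl
  · exact disjoint_left.1 (hZR _ (hXr j)).2.1 hb (hlt i j hl (hFa E b hs hc h1 hEW))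
  · exact disjoint_left.1 (hZR _ (hXr i)).2.1 ha (hlt j i hl (hFb E a hs.symm hc h2 hEW))

end Reach

section Robust

variable {V : Type} [DecidableEq V] {G : SimpleGraph V} {r : ℕ}

/-- Outside `W`, there is a bounded switch between `u` and `v` avoiding any given set of at most
`K` further vertices. -/
def Robust (G : SimpleGraph V) (r K c : ℕ) (W : Finset V) (u v : V) : Prop :=
  ∀ W', #W' ≤ K → u ∉ W' → v ∉ W' → Reach G r c (W ∪ W') u v

lemma Reach.symm {c : ℕ} {W : Finset V} {u v : V} (h : Reach G r c W u v) :
    Reach G r c W v u := by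
  obtain ⟨D, h1, h2⟩ := h
  exact ⟨D, h1.symm, h2⟩

lemma Robust.symm {K c : ℕ} {W : Finset V} {u v : V} (h : Robust G r K c W u v) :
    Robust G r K c W v u := fun W' h1 h2 h3 => (h W' h1 h3 h2).symm

/-- Two vertices with many common robust neighbours are robustly switchable. -/
lemma robust_of_hubs {K c : ℕ} {W Y H : Finset V} (hH : K < #H)
    (hHY : Disjoint H Y) (hr : ∀ h ∈ H, ∀ y ∈ Y, Robust G r (K + c + 1) c W h y) :
    ∀ y ∈ Y, ∀ y' ∈ Y, Robust G r K (2 * c) W y y' := by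
  intro y hy y' hy' W' hW' hyW' hyW''
  obtain ⟨h, hhH, hhW⟩ := exists_mem_notMem_of_card_lt_card (hW'.trans_lt hH)
  have hhY := disjoint_left.1 hHY hhH
  by_cases hyy : y = y'
  · subst hyy
    obtain ⟨D, hD1, hD2, hD3⟩ := hr h hhH y hy W' (by omega) hhW hyW'
    refine ⟨{y}, .refl y, ?_, ?_⟩
    · have : 0 < #D := card_pos.2 ⟨_, hD1.1⟩
      simp only [card_singleton]; omega
    · rw [disjoint_singleton_left]
      exact disjoint_left.1 hD3 hD1.2.1
  · have hhy : ∀ z ∈ Y, h ≠ z := by rintro z hz rfl; exact hhY hz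
    obtain ⟨D, hD1, hD2, hD3⟩ := hr h hhH y hy (insert y' W')
      ((card_insert_le _ _).trans (by omega)) (by simp [hhW, hhy y' hy']) (by simp [hyW', hyy])
    rw [union_insert, disjoint_insert_right] at hD3
    obtain ⟨D', hD'1, hD'2, hD'3⟩ := hr h hhH y' hy' (W' ∪ D.erase h)
      ((card_union_le _ _).trans (Nat.add_le_add hW' ((card_erase_le).trans hD2) |>.trans
        (by omega))) (by simp [hhW]) (by simp [hyW'', hD3.1])
    rw [← union_assoc, disjoint_union_right] at hD'3
    refine ⟨D ∪ D', hD1.symm.trans hD'1 ?_, (card_union_le _ _).trans (by omega), ?_⟩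
    · ext x
      simp only [mem_inter, mem_singleton]
      refine ⟨fun hx => ?_, ?_⟩
      · by_contra hxh
        exact disjoint_left.1 hD'3.2 hx.2 (mem_erase.2 ⟨hxh, hx.1⟩)
      · rintro rfl; exact ⟨hD1.1, hD'1.1⟩
    · exact disjoint_union_left.2 ⟨hD3.2, hD'3.1⟩

lemma SwitchProp.exists_robust_pair [Fintype V] {m : ℕ} (h : SwitchProp G r m) {W : Finset V}
    (P : Fin (r + 1) → Finset V) (hP : ∀ i j, i ≠ j → Disjoint (P i) (P j))
    (hPW : ∀ i, Disjoint (P i) W) {N c K K₁ : ℕ} (hK : 2 * (r + 1) * K ≤ K₁)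
    (hN : 2 * ((r + 1) * m * (1 + (c + K₁) + 2 * (c + K₁) * (r + 1))) < N)
    (u : Fin (r + 1) → V) (hu : ∀ i, Expanding G r N c K₁ (P i)ᶜ (u i)) :
    ∃ i j, i ≠ j ∧ Robust G r K (2 * c + r + 1) W (u i) (u j) := by
  by_contra! hcon
  have hex : ∀ i j, ∃ W' : Finset V, #W' ≤ K ∧ u i ∉ W' ∧ u j ∉ W' ∧
      (i ≠ j → ¬ Reach G r (2 * c + r + 1) (W ∪ W') (u i) (u j)) := by
    intro i j
    by_cases hij : i = j
    · exact ⟨∅, by simp, by simp, by simp, fun h => absurd hij h⟩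
    · have := hcon i j hij
      simp only [Robust] at this
      push Not at this
      obtain ⟨W', h1, h2, h3, h4⟩ := this
      exact ⟨W', h1, h2, h3, fun _ => h4⟩
  choose Wf hWf1 hWf2 hWf3 hWf4 using hex
  set W' : Fin (r + 1) → Finset V := fun i => univ.biUnion fun j => Wf i j ∪ Wf j i with hW'
  have hW'c : ∀ i, #(W' i) ≤ K₁ := by
    intro i
    refine le_trans (card_biUnion_le_card_mul _ _ (2 * K) fun j _ => ?_) (le_trans ?_ hK)
    · exact (card_union_le _ _).trans (by have := hWf1 i j; have := hWf1 j i; omega)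
    · simp only [card_univ, Fintype.card_fin]; apply le_of_eq; ring
  have huW : ∀ i, u i ∉ W' i := by
    intro i hi
    obtain ⟨j, -, hj⟩ := mem_biUnion.1 hi
    rcases mem_union.1 hj with h | h
    exacts [hWf2 i j h, hWf3 j i h]
  have hZ : ∀ i, ∃ Z ⊆ univ.filter fun v => Reach G r c ((P i)ᶜ ∪ W' i) (u i) v, #Z = N :=
    fun i => exists_subset_card_eq (hu i (W' i) (hW'c i) (huW i))
  choose Z hZs hZc using hZ
  have hZR : ∀ i, ∀ a ∈ Z i, ∃ D, IsSwitch G r D (u i) a ∧ #D ≤ c ∧ D ⊆ P i ∧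
      Disjoint D (W' i) := by
    intro i a ha
    obtain ⟨D, h1, h2, h3⟩ := (mem_filter.1 (hZs i ha)).2
    rw [disjoint_union_right, disjoint_compl_right_iff] at h3
    exact ⟨D, h1, h2, h3.1, h3.2⟩
  have hZP : ∀ i, Z i ⊆ P i := by
    intro i a ha
    obtain ⟨D, h1, h2, h3, -⟩ := hZR i a ha
    exact h3 h1.2.1
  obtain ⟨i, j, hij, a, ha, b, hb, E, hE, hs, hc, Fa, Fb, hFa, hFb, -, -, h1, h2⟩ :=
    h.exists_avoiding_of_forall Z (fun i j hij => (hP i j hij).mono (hZP i) (hZP j)) hZc hN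
      (P := fun i a F => ∃ D, F = D ∪ W' i ∧ IsSwitch G r D (u i) a ∧ #D ≤ c ∧ D ⊆ P i ∧
        Disjoint D (W' i)) (fun i a ha => by
        obtain ⟨D, h1, h2, h3, h4⟩ := hZR i a ha
        exact ⟨D ∪ W' i, (card_union_le _ _).trans (Nat.add_le_add h2 (hW'c i)), D, rfl, h1, h2,
          h3, h4⟩)
  obtain ⟨Da, rfl, hDa, hDac, hDaP, hDaW⟩ := hFa
  obtain ⟨Db, rfl, hDb, hDbc, hDbP, hDbW⟩ := hFb
  rw [disjoint_union_right] at h1 h2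
  have hsub : Wf i j ⊆ W' i ∧ Wf i j ⊆ W' j :=
    ⟨subset_union_left.trans (subset_biUnion_of_mem (fun j => Wf i j ∪ Wf j i) (mem_univ j)),
      subset_union_right.trans (subset_biUnion_of_mem (fun i => Wf j i ∪ Wf i j) (mem_univ i))⟩
  have hEW : Disjoint E W := disjoint_of_subset_left hE (by
    rw [disjoint_biUnion_left]
    exact fun i _ => (hPW i).mono_left (hZP i))
  refine hWf4 i j hij ⟨Da ∪ E ∪ Db, (hDa.extend hs h1.1).trans hDb.symm ?_, ?_, ?_⟩
  · ext x
    simp only [mem_inter, mem_union, mem_singleton]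
    refine ⟨fun hx => ?_, ?_⟩
    · by_contra hxb
      rcases hx.1 with hx1 | hx1
      · exact disjoint_left.1 (hP i j hij) (hDaP hx1) (hDbP hx.2)
      · exact disjoint_left.1 h2.1 (mem_erase.2 ⟨hxb, hx1⟩) hx.2
    · rintro rfl; exact ⟨Or.inr hs.2.1, hDb.2.1⟩
  · have := card_union_le Da E
    exact (card_union_le _ _).trans (by omega)
  · rw [disjoint_union_left, disjoint_union_left]
    simp only [disjoint_union_right]
    refine ⟨⟨⟨(hPW i).mono_left hDaP, hDaW.mono_right hsub.1⟩, hEW, ?_⟩,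
      (hPW j).mono_left hDbP, hDbW.mono_right hsub.2⟩
    rw [disjoint_left]
    intro x hx hxW
    by_cases hxa : x = a
    · subst hxa
      exact disjoint_left.1 hDaW hDa.2.1 (hsub.1 hxW)
    · exact disjoint_left.1 h1.2 (mem_erase.2 ⟨hxa, hx⟩) (hsub.1 hxW)

end Robust

/-- If every transversal of the sets `A i` contains a related pair, then some vertex is related to
a positive proportion of one of the sets. -/
lemma exists_hub {V : Type*} [DecidableEq V] [Nonempty V] {q : ℕ} (S : V → V → Prop)
    (hS : ∀ x y, S x y → S y x) (A : Fin q → Finset V)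
    (hA : ∀ i, (A i).Nonempty)
    (h : ∀ u : Fin q → V, (∀ i, u i ∈ A i) → ∃ i j, i ≠ j ∧ S (u i) (u j)) :
    ∃ i j, ∃ v ∈ A j, #(A i) ≤ q * #((A i).filter (S v)) := by
  set Good : Finset (Fin q) → Prop := fun I => ∃ u : Fin q → V, (∀ i ∈ I, u i ∈ A i) ∧
    ∀ i ∈ I, ∀ j ∈ I, i ≠ j → ¬ S (u i) (u j) with hGood
  obtain ⟨I, hI, hmax⟩ := exists_max_image (univ.filter Good) card
    ⟨∅, mem_filter.2 ⟨mem_univ _, fun _ => Classical.arbitrary V, by simp, by simp⟩⟩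
  obtain ⟨u, hu1, hu2⟩ := (mem_filter.1 hI).2
  have hIu : ∃ i, i ∉ I := by
    by_contra! hall
    obtain ⟨i, j, hij, hSij⟩ := h u fun i => hu1 i (hall i)
    exact hu2 i (hall i) j (hall j) hij hSij
  obtain ⟨i, hi⟩ := hIu
  have hne : ∀ j ∈ I, j ≠ i := by rintro j hj rfl; exact hi hj
  have hcov : A i ⊆ I.biUnion fun j => (A i).filter (S (u j)) := by
    intro y hy
    by_contra hny
    have hny' : ∀ j ∈ I, ¬ S (u j) y := fun j hj hs =>
      hny (mem_biUnion.2 ⟨j, hj, mem_filter.2 ⟨hy, hs⟩⟩)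
    have := hmax (insert i I) (mem_filter.2 ⟨mem_univ _, Function.update u i y, ?_, ?_⟩)
    · rw [card_insert_of_notMem hi] at this; omega
    · intro j hj
      rcases mem_insert.1 hj with hj | hj
      · rw [hj, Function.update_self]; exact hy
      · rw [Function.update_of_ne (hne j hj)]; exact hu1 j hj
    · intro j hj k hk hjk
      rcases mem_insert.1 hj with hj | hj <;> rcases mem_insert.1 hk with hk | hk
      · exact absurd (hj.trans hk.symm) hjk
      · rw [hj, Function.update_self, Function.update_of_ne (hne k hk)]
        exact fun hs => hny' k hk (hS _ _ hs)
      · rw [hk, Function.update_self, Function.update_of_ne (hne j hj)]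
        exact hny' j hj
      · rw [Function.update_of_ne (hne j hj), Function.update_of_ne (hne k hk)]
        exact hu2 j hj k hk hjk
  by_contra! hcon
  have h1 : #(A i) * q ≤ ∑ j ∈ I, q * #((A i).filter (S (u j))) := by
    rw [← mul_sum, mul_comm]
    exact Nat.mul_le_mul_left _ ((card_le_card hcov).trans card_biUnion_le)
  have hq : #I ≤ q := by simpa using card_le_univ I
  rcases I.eq_empty_or_nonempty with rfl | hIne
  · obtain ⟨y, hy⟩ := hA i
    simpa using hcov hy
  · have h2 := sum_lt_sum_of_nonempty hIne fun j hj => hcon i j (u j) (hu1 j hj)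
    rw [sum_const, smul_eq_mul] at h2
    have := Nat.mul_le_mul_right #(A i) hq
    linarith [mul_comm q #(A i)]

lemma exists_many_hubs {V : Type*} [DecidableEq V] [Nonempty V] {q : ℕ} (S : V → V → Prop)
    (hS : ∀ x y, S x y → S y x) (A : Fin q → Finset V) (g : ℕ) (hg : ∀ i, g ≤ #(A i))
    (h : ∀ u : Fin q → V, (∀ i, u i ∈ A i) → ∃ i j, i ≠ j ∧ S (u i) (u j)) (T : ℕ)
    (hT : (2 * q) ^ T ≤ g) :
    ∃ B H : Fin q → Finset V, (∀ i, B i ⊆ A i) ∧ (∀ i, g ≤ (2 * q) ^ T * #(B i)) ∧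
      ∑ i, #(H i) = T ∧ (∀ i, ∀ v ∈ H i, (∀ j, v ∉ B j) ∧ ∀ y ∈ B i, S v y) := by
  induction T with
  | zero => exact ⟨A, fun _ => ∅, fun _ => subset_rfl, by simpa using hg, by simp, by simp⟩
  | succ T ih =>
    rcases Nat.eq_zero_or_pos q with rfl | hq
    · obtain ⟨i, -⟩ := h (fun i => i.elim0) fun i => i.elim0
      exact i.elim0
    obtain ⟨B, H, hB1, hB2, hH1, hH2⟩ := ih
      ((Nat.pow_le_pow_right (by omega) (Nat.le_succ T)).trans hT)
    have hpos : 0 < (2 * q) ^ T := by positivity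
    have hBq : ∀ k, 2 * q ≤ #(B k) := by
      intro k
      have := hT.trans (hB2 k)
      rw [pow_succ] at this
      exact Nat.le_of_mul_le_mul_left this hpos
    obtain ⟨i, j, v, hv, hiv⟩ := exists_hub S hS B
      (fun k => card_pos.1 (by have := hBq k; omega)) fun u hu => h u fun i => hB1 i (hu i)
    have hvH : v ∉ H i := fun hvH => (hH2 i v hvH).1 j hv
    have hsub : ∀ k, ((B k).filter fun y => k = i → S v y).erase v ⊆ B k := fun k =>
      (erase_subset _ _).trans (filter_subset _ _)
    refine ⟨fun k => ((B k).filter fun y => k = i → S v y).erase v,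
      Function.update H i (insert v (H i)), fun k => (hsub k).trans (hB1 k), ?_, ?_, ?_⟩
    · intro k
      refine (hB2 k).trans ?_
      rw [pow_succ, mul_assoc]
      refine Nat.mul_le_mul_left _ ?_
      have h1 := pred_card_le_card_erase (a := v) (s := (B k).filter fun y => k = i → S v y)
      have h2 : #(B k) ≤ q * #((B k).filter fun y => k = i → S v y) := by
        by_cases hk : k = i
        · subst hk; simpa using hiv
        · simp only [hk, false_imp_iff, filter_true]
          exact Nat.le_mul_of_pos_left _ hq
      set a := #((B k).filter fun y => k = i → S v y)
      have h3 : 2 ≤ a := by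
        have := (hBq k).trans h2
        rw [mul_comm] at this
        exact Nat.le_of_mul_le_mul_left this hq
      calc #(B k) ≤ q * a := h2
        _ ≤ q * (2 * (a - 1)) := Nat.mul_le_mul_left _ (by omega)
        _ = 2 * q * (a - 1) := by ring
        _ ≤ _ := Nat.mul_le_mul_left _ h1
    · rw [← hH1, ← add_sum_erase _ _ (mem_univ i), Function.update_self,
        ← add_sum_erase univ (fun i => #(H i)) (mem_univ i), card_insert_of_notMem hvH,
        add_right_comm]
      congr 2
      exact sum_congr rfl fun k hk => by rw [Function.update_of_ne (ne_of_mem_erase hk)]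
    · intro k w hw
      by_cases hk : k = i
      · subst hk
        rw [Function.update_self, mem_insert] at hw
        rcases hw with rfl | hw
        · exact ⟨fun l hl => by
            by_cases hl' : w ∈ B l
            · exact (notMem_erase w _ hl)
            · exact hl' (hsub l hl), fun y hy => (mem_filter.1 (mem_of_mem_erase hy)).2 rfl⟩
        · exact ⟨fun l hl => (hH2 k w hw).1 l (hsub l hl), fun y hy => (hH2 k w hw).2 y (hsub k hy)⟩
      · rw [Function.update_of_ne hk] at hw
        exact ⟨fun l hl => (hH2 k w hw).1 l (hsub l hl), fun y hy => (hH2 k w hw).2 y (hsub k hy)⟩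

lemma exists_disjoint_family {V : Type*} [DecidableEq V] (q s : ℕ) (A : Finset V)
    (h : q * s ≤ #A) : ∃ P : Fin q → Finset V, (∀ i j, i ≠ j → Disjoint (P i) (P j)) ∧
      (∀ i, P i ⊆ A) ∧ ∀ i, #(P i) = s := by
  obtain ⟨f⟩ := Function.Embedding.nonempty_of_card_le (α := Fin q × Fin s) (β := A) (by simpa)
  refine ⟨fun i => univ.image fun k => (f (i, k) : V), ?_, ?_, ?_⟩
  · intro i j hij
    rw [disjoint_left]
    intro x hx hx'
    obtain ⟨k, -, rfl⟩ := mem_image.1 hx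
    obtain ⟨l, -, hl⟩ := mem_image.1 hx'
    exact hij (by simpa using (congrArg Prod.fst (f.injective (Subtype.ext hl))).symm)
  · intro i x hx
    obtain ⟨k, -, rfl⟩ := mem_image.1 hx
    exact (f (i, k)).2
  · intro i
    rw [card_image_of_injective _ fun k l hkl => by
      simpa using f.injective (Subtype.ext hkl)]
    simp

/-- Outside any small set `W`, there is a set of linear size whose vertices are pairwise robustly
switchable. -/
lemma SwitchProp.exists_robust_set {V : Type} [Fintype V] [DecidableEq V] [Nonempty V]
    {G : SimpleGraph V} {r m : ℕ}
    (h : SwitchProp G r m) (W : Finset V) {N K c c₂ K₂ K₁ J t s g T : ℕ} (ht : 1 ≤ t)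
    (hJ : N ≤ t ^ J) (hc : c = 1 + J * r) (hc₂ : c₂ = 2 * c + r + 1) (hK₂ : K₂ = K + c₂ + 1)
    (hK₁ : K₁ = 2 * (r + 1) * K₂) (hTK : T = (r + 1) * K + 1)
    (hN : 2 * ((r + 1) * m * (1 + (c + K₁) + 2 * (c + K₁) * (r + 1))) < N)
    (hs : (r + 1) * s ≤ #Wᶜ) (hg : N + (r + 1) * (t * N) + g ≤ s)
    (hT : (2 * (r + 1)) ^ T ≤ g) :
    ∃ Y, Disjoint Y W ∧ g ≤ (2 * (r + 1)) ^ T * #Y ∧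
      ∀ y ∈ Y, ∀ y' ∈ Y, Robust G r K (2 * c₂) W y y' := by
  obtain ⟨P, hP, hPW, hPs⟩ := exists_disjoint_family (r + 1) s Wᶜ hs
  have hPW' : ∀ i, Disjoint (P i) W := fun i =>
    disjoint_of_subset_left (hPW i) disjoint_compl_left
  set A : Fin (r + 1) → Finset V := fun i =>
    (P i).filter fun u => Expanding G r N c K₁ (P i)ᶜ u with hA
  have hAg : ∀ i, g ≤ #(A i) := by
    intro i
    have h1 := h.card_not_expanding_lt (P i)ᶜ (K := K₁) ht hJ (by rw [← hc]; exact hN)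
    rw [← hc] at h1
    have h2 := card_filter_add_card_filter_not (s := P i)
      (fun u => Expanding G r N c K₁ (P i)ᶜ u)
    have h3 : #((P i).filter fun u => ¬ Expanding G r N c K₁ (P i)ᶜ u) ≤
        #(univ.filter fun u => u ∉ (P i)ᶜ ∧ ¬ Expanding G r N c K₁ (P i)ᶜ u) := by
      refine card_le_card fun u hu => ?_
      have := mem_filter.1 hu
      simpa using this
    rw [hPs] at h2
    simp only [hA]
    omega
  obtain ⟨B, H, hB1, hB2, hH1, hH2⟩ := exists_many_hubs (Robust G r K₂ c₂ W)
    (fun x y hxy => hxy.symm) A g hAg (fun u hu => by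
      subst hc₂
      exact h.exists_robust_pair P hP hPW' hK₁.symm.le hN u fun i => (mem_filter.1 (hu i)).2) T hT
  have : ∃ i, K < #(H i) := by
    by_contra! hcon
    have := sum_le_sum fun i (_ : i ∈ univ) => hcon i
    rw [hH1] at this
    simp at this
    omega
  obtain ⟨i, hi⟩ := this
  refine ⟨B i, disjoint_of_subset_left ((hB1 i).trans (filter_subset _ _)) (hPW' i), hB2 i, ?_⟩
  exact robust_of_hubs hi (disjoint_left.2 fun x hx => (hH2 i x hx).1 i)
    (by rw [← hK₂]; exact fun x hx y hy => (hH2 i x hx).2 y hy)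
section Hubs

variable {V : Type} [DecidableEq V] {G : SimpleGraph V} {r : ℕ}

/-- Pairwise robustly switchable vertices lie in a common set such that deleting any of them
leaves a set with a `K_r`-factor. -/
lemma exists_multiswitch {ι : Type*} [DecidableEq ι] {K c : ℕ} {W S : Finset V}
    (hS : ∀ y ∈ S, ∀ y' ∈ S, Robust G r K c W y y') (hSW : Disjoint S W) (J : Finset ι)
    (hJ : J.Nonempty) (t : ι → V) (ht : ∀ i ∈ J, ∀ j ∈ J, t i = t j → i = j)
    (htS : ∀ i ∈ J, t i ∈ S) (A : Finset V) (htA : ∀ i ∈ J, t i ∉ A)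
    (hK : #A + #J * (c + 1) ≤ K) :
    ∃ E, Disjoint E (W ∪ A) ∧ #E ≤ 1 + #J * c ∧
      ∀ i ∈ J, t i ∈ E ∧ HasKrFactorOn G r (E.erase (t i)) := by
  induction hJ using Finset.Nonempty.cons_induction generalizing A with
  | singleton a =>
    refine ⟨{t a}, ?_, by simp, ?_⟩
    · rw [disjoint_singleton_left, mem_union]
      have h1 := htA a (by simp)
      have h2 := disjoint_left.1 hSW (htS a (by simp))
      tauto
    · intro i hi
      rw [mem_singleton.1 hi]
      simp [hasKrFactorOn_empty]
  | cons a J ha hJ ih =>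
    simp only [cons_eq_insert] at *
    rw [card_insert_of_notMem ha] at hK ⊢
    have hsub : ∀ i ∈ J, i ∈ insert a J := fun i hi => mem_insert_of_mem hi
    have haa := mem_insert_self a J
    have hne : ∀ i ∈ J, t i ≠ t a := fun i hi h => by
      have := ht i (hsub i hi) a haa h
      subst this; exact ha hi
    have hins := card_insert_le (t a) A
    rw [add_mul, one_mul] at hK
    obtain ⟨E, hE1, hE2, hE3⟩ := ih (fun i hi j hj => ht i (hsub i hi) j (hsub j hj))
      (fun i hi => htS i (hsub i hi)) (insert (t a) A) (fun i hi => by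
        simp [hne i hi, htA i (hsub i hi)]) (by omega)
    obtain ⟨i₀, hi₀⟩ := hJ
    rw [union_insert, disjoint_insert_right] at hE1
    have h1 : #J * (c + 1) = #J * c + #J := by ring
    have h2 := card_union_le A (E.erase (t i₀))
    have h3 := card_erase_le (s := E) (a := t i₀)
    have h4 : 0 < #J := card_pos.2 ⟨_, hi₀⟩
    obtain ⟨D, hD1, hD2, hD3⟩ := hS (t i₀) (htS _ (hsub _ hi₀)) (t a) (htS _ haa)
      (A ∪ E.erase (t i₀)) (by omega) (by simp [htA _ (hsub _ hi₀)]) (by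
        simp [htA _ haa, hE1.1])
    rw [← union_assoc, disjoint_union_right] at hD3
    have hED : E ∩ D = {t i₀} := by
      ext x
      simp only [mem_inter, mem_singleton]
      refine ⟨fun hx => ?_, ?_⟩
      · by_contra hxh
        exact disjoint_left.1 hD3.2 hx.2 (mem_erase.2 ⟨hxh, hx.1⟩)
      · rintro rfl; exact ⟨(hE3 _ hi₀).1, hD1.1⟩
    refine ⟨E ∪ D, disjoint_union_left.2 ⟨hE1.2, hD3.1⟩, (card_union_le _ _).trans ?_, ?_⟩
    · rw [add_mul, one_mul]; omega
    · intro i hi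
      rcases mem_insert.1 hi with hi | hi
      · rw [hi]
        refine ⟨mem_union_right _ hD1.2.1, ?_⟩
        rw [union_comm]
        exact hD1.2.2.2.erase_union (hE3 _ hi₀).2 hD1.2.1 hD1.1 (by rw [inter_comm, hED])
      · exact ⟨mem_union_left _ (hE3 i hi).1, (hE3 i hi).2.erase_union hD1.2.2.1 (hE3 i hi).1
          (hE3 _ hi₀).1 hED⟩

/-- Cliques `T i` in the neighbourhoods of vertices `x i` extend to a common set `D` which has a
`K_r`-factor together with any one of the vertices `x i`. -/
lemma exists_hub_set {ι : Type*} [DecidableEq ι] {K c q : ℕ} {W S : Finset V}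
    (hS : ∀ y ∈ S, ∀ y' ∈ S, Robust G r K c W y y') (hSW : Disjoint S W) (J : Finset ι)
    (hJ : J.Nonempty) (x : ι → V) (T : ι → Finset V) (W' : Finset V)
    (hTS : ∀ i ∈ J, T i ⊆ S) (hTW : ∀ i ∈ J, Disjoint (T i) W')
    (hTT : ∀ i ∈ J, ∀ j ∈ J, i ≠ j → Disjoint (T i) (T j)) (hTx : ∀ i ∈ J, ∀ j ∈ J, x i ∉ T j)
    (hTq : ∀ i ∈ J, #(T i) = q) (hTc : ∀ i ∈ J, G.IsNClique r (insert (x i) (T i)))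
    (hK : #W' + (q + 2) * (#J * (c + 3)) ≤ K) :
    ∃ D, Disjoint D (W ∪ W') ∧ #D ≤ q * (1 + #J * c) ∧
      ∀ i ∈ J, x i ∉ D ∧ HasKrFactorOn G r (insert (x i) D) := by
  have hex : ∀ i, ∃ f : Fin q → V, i ∈ J → Function.Injective f ∧ univ.image f = T i := by
    intro i
    by_cases hi : i ∈ J
    · let e := (T i).equivFinOfCardEq (hTq i hi)
      refine ⟨fun s => e.symm s, fun _ => ⟨fun s t h => e.symm.injective (Subtype.ext h), ?_⟩⟩
      ext v
      simp only [mem_image, mem_univ, true_and]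
      refine ⟨?_, fun hv => ⟨e ⟨v, hv⟩, by simp⟩⟩
      rintro ⟨s, rfl⟩; exact (e.symm s).2
    · obtain ⟨i, hi'⟩ := hJ
      have hc := hTq i hi'
      refine ⟨fun s => x i, fun h => absurd h hi⟩
  choose t ht using hex
  have htT : ∀ i ∈ J, ∀ s, t i s ∈ T i := fun i hi s => by
    rw [← (ht i hi).2]; exact mem_image_of_mem _ (mem_univ s)
  have httne : ∀ i ∈ J, ∀ j ∈ J, ∀ s u, t i s = t j u → i = j ∧ s = u := by
    intro i hi j hj s u h
    by_cases hij : i = j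
    · subst hij; exact ⟨rfl, (ht i hi).1 h⟩
    · exact absurd (h ▸ htT i hi s) (disjoint_right.1 (hTT i hi j hj hij) (htT j hj u))
  set B : Finset V := W' ∪ J.image x with hB
  have hBc : #B ≤ #W' + #J := (card_union_le _ _).trans (by gcongr; exact card_image_le)
  have htB : ∀ i ∈ J, ∀ s, t i s ∉ B := by
    intro i hi s hsB
    rcases mem_union.1 hsB with h | h
    · exact disjoint_left.1 (hTW i hi) (htT i hi s) h
    · obtain ⟨j, hj, hjx⟩ := mem_image.1 h
      exact hTx j hj i hi (hjx ▸ htT i hi s)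
  have hJpos : 0 < #J := card_pos.2 hJ
  have key : ∀ σ : Finset (Fin q), ∃ E : Fin q → Finset V,
      (∀ s ∈ σ, Disjoint (E s) (W ∪ B) ∧ #(E s) ≤ 1 + #J * c ∧
        (∀ i ∈ J, t i s ∈ E s ∧ HasKrFactorOn G r ((E s).erase (t i s))) ∧
        ∀ i ∈ J, ∀ u, u ≠ s → t i u ∉ E s) ∧
      ∀ s ∈ σ, ∀ u ∈ σ, s ≠ u → Disjoint (E s) (E u) := by
    intro σ
    induction σ using Finset.induction_on with
    | empty => exact ⟨fun _ => ∅, by simp, by simp⟩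
    | insert a σ ha ih =>
      obtain ⟨E, hE1, hE2⟩ := ih
      set T' := J.biUnion fun i => (univ.erase a).image (t i) with hT'
      have hT'c : #T' ≤ #J * q := card_biUnion_le_card_mul _ _ _ fun i _ =>
        card_image_le.trans ((card_le_univ _).trans (by simp))
      have hσ : #σ ≤ q := (card_le_univ σ).trans (by simp)
      have hEc : #(σ.biUnion E) ≤ q * (1 + #J * c) :=
        (card_biUnion_le_card_mul _ _ _ fun s hs => (hE1 s hs).2.1).trans
          (Nat.mul_le_mul_right _ hσ)
      have hA : #(B ∪ T' ∪ σ.biUnion E) ≤ #W' + #J + #J * q + q * (1 + #J * c) :=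
        (card_union_le _ _).trans (Nat.add_le_add ((card_union_le _ _).trans
          (Nat.add_le_add hBc hT'c)) hEc)
      obtain ⟨E', h1, h2, h3⟩ := exists_multiswitch hS hSW J hJ (fun i => t i a)
        (fun i hi j hj h => (httne i hi j hj a a h).1) (fun i hi => hTS i hi (htT i hi a))
        (B ∪ T' ∪ σ.biUnion E) (by
          intro i hi hmem
          rw [mem_union, mem_union] at hmem
          rcases hmem with (h | h) | h
          · exact htB i hi a h
          · obtain ⟨j, hj, h⟩ := mem_biUnion.1 h
            obtain ⟨u, hu, h⟩ := mem_image.1 h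
            exact ne_of_mem_erase hu (httne j hj i hi u a h).2
          · obtain ⟨s, hs, h⟩ := mem_biUnion.1 h
            exact (hE1 s hs).2.2.2 i hi a (by rintro rfl; exact ha hs) h) (by
          refine (Nat.add_le_add_right hA _).trans (le_trans ?_ hK)
          have : q * 1 ≤ q * #J := Nat.mul_le_mul_left _ hJpos
          ring_nf at this ⊢
          nlinarith)
      rw [← union_assoc, ← union_assoc, disjoint_union_right, disjoint_union_right] at h1
      have hne : ∀ s ∈ σ, s ≠ a := by rintro s hs rfl; exact ha hs
      have hE'σ : ∀ s ∈ σ, Disjoint E' (E s) := fun s hs =>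
        h1.2.mono_right (subset_biUnion_of_mem E hs)
      refine ⟨Function.update E a E', ?_, ?_⟩
      · intro s hs
        rcases mem_insert.1 hs with hs | hs
        · rw [hs, Function.update_self]
          refine ⟨h1.1.1, h2, h3, fun i hi u hu => ?_⟩
          exact disjoint_right.1 h1.1.2 (mem_biUnion.2 ⟨i, hi, mem_image_of_mem _
            (mem_erase.2 ⟨hu, mem_univ _⟩)⟩)
        · rw [Function.update_of_ne (hne s hs)]; exact hE1 s hs
      · intro s hs u hu hsu
        rcases mem_insert.1 hs with hs | hs <;> rcases mem_insert.1 hu with hu | hu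
        · exact absurd (hs.trans hu.symm) hsu
        · rw [hs, Function.update_self, Function.update_of_ne (hne u hu)]
          exact hE'σ u hu
        · rw [hu, Function.update_self, Function.update_of_ne (hne s hs)]
          exact (hE'σ s hs).symm
        · rw [Function.update_of_ne (hne s hs), Function.update_of_ne (hne u hu)]
          exact hE2 s hs u hu hsu
  obtain ⟨E, hE1, hE2⟩ := key univ
  have hDB : Disjoint (univ.biUnion E) (W ∪ B) :=
    (disjoint_biUnion_left _ _ _).2 fun s _ => (hE1 s (mem_univ s)).1
  refine ⟨univ.biUnion E, hDB.mono_right (union_subset_union subset_rfl subset_union_left), ?_, ?_⟩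
  · refine (card_biUnion_le_card_mul _ _ _ fun s hs => (hE1 s hs).2.1).trans ?_
    simp
  · intro i hi
    have hxD : x i ∉ univ.biUnion E := fun h => disjoint_left.1 hDB h
      (mem_union_right _ (mem_union_right _ (mem_image_of_mem _ hi)))
    refine ⟨hxD, ?_⟩
    have : insert (x i) (univ.biUnion E) =
        univ.biUnion (fun s => (E s).erase (t i s)) ∪ insert (x i) (T i) := by
      ext v
      rw [← (ht i hi).2]
      simp only [mem_insert, mem_biUnion, mem_univ, true_and, mem_union, mem_erase, mem_image]
      constructor
      · rintro (h | ⟨s, hs⟩)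
        · tauto
        · by_cases hv : v = t i s
          · exact Or.inr (Or.inr ⟨s, hv.symm⟩)
          · exact Or.inl ⟨s, hv, hs⟩
      · rintro (⟨s, -, hs⟩ | h | ⟨s, rfl⟩)
        · exact Or.inr ⟨s, hs⟩
        · exact Or.inl h
        · exact Or.inr ⟨s, ((hE1 s (mem_univ s)).2.2.1 i hi).1⟩
    rw [this]
    refine (HasKrFactorOn.biUnion _ _ (fun s hs => ((hE1 s hs).2.2.1 i hi).2)
      fun s hs u hu hsu => (hE2 s hs u hu hsu).mono (erase_subset _ _) (erase_subset _ _)).union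
      (.of_isNClique (hTc i hi)) ?_
    rw [disjoint_biUnion_left]
    intro s _
    rw [disjoint_insert_right]
    refine ⟨fun h => hxD (mem_biUnion.2 ⟨s, mem_univ s, mem_of_mem_erase h⟩), ?_⟩
    rw [disjoint_right]
    intro v hv hvE
    rw [← (ht i hi).2] at hv
    obtain ⟨u, -, rfl⟩ := mem_image.1 hv
    obtain ⟨hne, hvE⟩ := mem_erase.1 hvE
    by_cases hus : u = s
    · subst hus; exact hne rfl
    · exact (hE1 s (mem_univ s)).2.2.2 i hi u hus hvE

/-- Robust switchability propagates to vertices which have many cliques of robustly switchable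
vertices in their neighbourhoods. -/
lemma robust_of_cliques {K K' c q : ℕ} {W S : Finset V}
    (hS : ∀ y ∈ S, ∀ y' ∈ S, Robust G r K c W y y') (hSW : Disjoint S W) {x x' : V}
    (hx : x ∉ W) (hx' : x' ∉ W) (hq : q + 1 = r)
    (hT : ∀ z, z = x ∨ z = x' → ∀ A : Finset V, #A ≤ K' + q + 2 → ∃ T ⊆ S, Disjoint T A ∧
      #T = q ∧ G.IsNClique r (insert z T))
    (hK : K' + (q + 2) * (2 * (c + 3)) ≤ K) :
    Robust G r K' (2 + q * (1 + 2 * c)) W x x' := by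
  intro W' hW' hxW' hxW''
  by_cases hxx : x = x'
  · subst hxx
    exact ⟨{x}, .refl x, by simp; omega, by simp [hx, hxW']⟩
  obtain ⟨T, hT1, hT2, hT3, hT4⟩ := hT x (Or.inl rfl) (insert x (insert x' W')) (by
    have := card_insert_le x (insert x' W')
    have := card_insert_le x' W'
    omega)
  obtain ⟨T', hT'1, hT'2, hT'3, hT'4⟩ := hT x' (Or.inr rfl) (insert x (insert x' W') ∪ T) (by
    have := card_insert_le x (insert x' W')
    have := card_insert_le x' W'
    have := card_union_le (insert x (insert x' W')) T
    omega)
  rw [disjoint_union_right] at hT'2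
  simp only [disjoint_insert_right] at hT2 hT'2
  obtain ⟨D, hD1, hD2, hD3⟩ := exists_hub_set hS hSW (univ : Finset Bool) univ_nonempty
    (fun b => cond b x x') (fun b => cond b T T') W' (q := q) (by simp [hT1, hT'1])
    (by simp [hT2, hT'2]) (by simp [hT'2.2, hT'2.2.symm]) (by simp [hT2, hT'2])
    (by simp [hT3, hT'3]) (by simp [hT4, hT'4]) (by simpa using hK.trans' (by omega))
  have h1 := hD3 true (mem_univ _)
  have h2 := hD3 false (mem_univ _)
  simp only [cond_true, cond_false] at h1 h2
  refine ⟨insert x (insert x' D), ⟨by simp, by simp, ?_, ?_⟩, ?_, ?_⟩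
  · rw [erase_insert (by simp [hxx, h1.1])]; exact h2.2
  · rw [insert_comm, erase_insert (by simp [Ne.symm hxx, h2.1])]; exact h1.2
  · have := card_insert_le x (insert x' D)
    have := card_insert_le x' D
    simp only [card_univ, Fintype.card_bool] at hD2
    omega
  · rw [disjoint_insert_left, disjoint_insert_left]
    simp [hx, hx', hxW', hxW'', hD1]

end Hubs

section Degrees

variable {V : Type} [DecidableEq V]

/-- Among any `b` vertices some vertex has at least `#Y * p / 2` neighbours in a given set `Y`
with at least `y` elements. -/
def DegProp (G : SimpleGraph V) (b : ℕ) (y p : ℝ) : Prop :=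
  ∀ X Y : Finset V, Disjoint X Y → b ≤ #X → y ≤ (#Y : ℝ) →
    ∃ v ∈ X, (#Y : ℝ) * p / 2 ≤ #(Y.filter (G.Adj v))

/-- Every set of at least `e` neighbours of some vertex contains a clique of size `q`. -/
def CliqueProp (G : SimpleGraph V) (q : ℕ) (e : ℝ) : Prop :=
  ∀ v, ∀ X : Finset V, (∀ x ∈ X, G.Adj v x) → e ≤ (#X : ℝ) → ∃ S ⊆ X, G.IsNClique q S

variable {G : SimpleGraph V}

lemma CliqueProp.exists_clique {q : ℕ} {e : ℝ} (h : CliqueProp G q e) {v : V} {X A : Finset V}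
    (hX : e + #A ≤ (#(X.filter (G.Adj v)) : ℝ)) :
    ∃ S ⊆ X, Disjoint S A ∧ #S = q ∧ G.IsNClique (q + 1) (insert v S) := by
  have h1 : #(X.filter (G.Adj v)) ≤ #(X.filter (G.Adj v) \ A) + #A := by
    have := le_card_sdiff A (X.filter (G.Adj v))
    omega
  have h2 : (#(X.filter (G.Adj v)) : ℝ) ≤ #(X.filter (G.Adj v) \ A) + #A := by exact_mod_cast h1
  obtain ⟨S, hS, hc⟩ := h v (X.filter (G.Adj v) \ A)
    (fun x hx => (mem_filter.1 (mem_sdiff.1 hx).1).2) (by linarith)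
  refine ⟨S, hS.trans (sdiff_subset.trans (filter_subset _ _)),
    disjoint_of_subset_left hS sdiff_disjoint, hc.card_eq, hc.insert fun x hx => ?_⟩
  exact (mem_filter.1 (mem_sdiff.1 (hS hx)).1).2

lemma DegProp.card_low_lt [Fintype V] {b : ℕ} {y p : ℝ} (h : DegProp G b y p) (hp : 0 ≤ p)
    {Y : Finset V} (hb : 2 * b ≤ #Y) (hy : 2 * y ≤ (#Y : ℝ)) :
    #(univ.filter fun v => (#(Y.filter (G.Adj v)) : ℝ) < #Y * p / 4) < b := by
  by_contra! hcon
  obtain ⟨X, hX, hXc⟩ := exists_subset_card_eq hcon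
  have h1 : (#Y : ℝ) ≤ #(Y \ X) + #X := by
    have := le_card_sdiff X Y
    exact_mod_cast (by omega : #Y ≤ #(Y \ X) + #X)
  have hb' : 2 * (b : ℝ) ≤ #Y := by exact_mod_cast hb
  have h2 : (#Y : ℝ) / 2 ≤ #(Y \ X) := by rw [hXc] at h1; linarith
  obtain ⟨v, hv, hvd⟩ := h X (Y \ X) disjoint_sdiff hXc.ge (by linarith)
  have h3 := (mem_filter.1 (hX hv)).2
  have h4 : (#((Y \ X).filter (G.Adj v)) : ℝ) ≤ #(Y.filter (G.Adj v)) := by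
    exact_mod_cast card_le_card (filter_subset_filter _ sdiff_subset)
  nlinarith

lemma robust_of_card {r K K' c q : ℕ} {e : ℝ} {W S : Finset V} (hC : CliqueProp G q e)
    (hS : ∀ y ∈ S, ∀ y' ∈ S, Robust G r K c W y y') (hSW : Disjoint S W) {x x' : V}
    (hx : x ∉ W) (hx' : x' ∉ W) (hq : q + 1 = r)
    (hd : e + (K' + q + 2) ≤ (#(S.filter (G.Adj x)) : ℝ))
    (hd' : e + (K' + q + 2) ≤ (#(S.filter (G.Adj x')) : ℝ))
    (hK : K' + (q + 2) * (2 * (c + 3)) ≤ K) :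
    Robust G r K' (2 + q * (1 + 2 * c)) W x x' := by
  refine robust_of_cliques hS hSW hx hx' hq (fun z hz A hA => ?_) hK
  have hA' : (#A : ℝ) ≤ K' + q + 2 := by exact_mod_cast hA
  subst hq
  exact hC.exists_clique (by rcases hz with rfl | rfl <;> linarith)

lemma reach_of_robust_set [Fintype V] {r b c K₁ K q : ℕ} {y p e : ℝ} (hD : DegProp G b y p)
    (hC : CliqueProp G q e) (hp : 0 ≤ p) {W Y : Finset V} (hYW : Disjoint Y W)
    (hY : ∀ y ∈ Y, ∀ y' ∈ Y, Robust G r K c W y y') (hq : q + 1 = r) (hb : 2 * b ≤ #Y)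
    (hy : 2 * y ≤ (#Y : ℝ)) (hYe : e + (K₁ + q + 2) ≤ (#Y : ℝ) * p / 4)
    (hK : K₁ + (q + 2) * (2 * (c + 3)) ≤ K)
    (hK₁ : (q + 2) * (2 * (2 + q * (1 + 2 * c) + 3)) ≤ K₁) {x x' : V} (hx : x ∉ W) (hx' : x' ∉ W)
    (hd : e + (q + 2) + b ≤ (#(Wᶜ.filter (G.Adj x)) : ℝ))
    (hd' : e + (q + 2) + b ≤ (#(Wᶜ.filter (G.Adj x')) : ℝ)) :
    Reach G r (2 + q * (1 + 2 * (2 + q * (1 + 2 * c)))) W x x' := by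
  set B := univ.filter fun v => (#(Y.filter (G.Adj v)) : ℝ) < #Y * p / 4 with hB
  have hBc : #B < b := hD.card_low_lt hp hb hy
  set S := Wᶜ \ B with hS
  have hSB : ∀ v ∈ S, (#Y * p / 4 : ℝ) ≤ #(Y.filter (G.Adj v)) := by
    intro v hv
    have := (mem_sdiff.1 hv).2
    simpa [hB] using this
  have hSW : ∀ v ∈ S, v ∉ W := fun v hv => by simpa using (mem_sdiff.1 hv).1
  have hSd : ∀ x, e + (q + 2) + b ≤ (#(Wᶜ.filter (G.Adj x)) : ℝ) →
      e + ((0 : ℕ) + q + 2) ≤ (#(S.filter (G.Adj x)) : ℝ) := by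
    intro x hx
    have h1 : #(Wᶜ.filter (G.Adj x)) ≤ #(S.filter (G.Adj x)) + b := by
      refine le_trans (card_le_card ?_) ((card_union_le _ _).trans (Nat.add_le_add_left hBc.le _))
      intro v hv
      obtain ⟨hv1, hv2⟩ := mem_filter.1 hv
      by_cases hvB : v ∈ B
      · exact mem_union_right _ hvB
      · exact mem_union_left _ (mem_filter.2 ⟨mem_sdiff.2 ⟨hv1, hvB⟩, hv2⟩)
    have h2 : (#(Wᶜ.filter (G.Adj x)) : ℝ) ≤ #(S.filter (G.Adj x)) + b := by exact_mod_cast h1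
    push_cast
    linarith
  have := robust_of_card (K' := 0) hC (S := S) (fun u hu u' hu' => robust_of_card hC hY hYW
    (hSW u hu) (hSW u' hu') hq (hYe.trans (hSB u hu)) (hYe.trans (hSB u' hu')) hK)
    (disjoint_left.2 hSW) hx hx' hq (hSd x hd) (hSd x' hd') (by simpa using hK₁)
  simpa using this ∅ (by simp) (by simp) (by simp)

end Degrees

section Template

lemma choose_le_three_mul_div_pow (n a : ℕ) (ha : 0 < a) :
    (n.choose a : ℝ) ≤ (3 * n / a) ^ a := by
  have ha' : (0 : ℝ) < a := by exact_mod_cast ha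
  have h1 : (a : ℝ) ^ a / a.factorial ≤ 3 ^ a := by
    refine (Real.pow_div_factorial_le_exp (a : ℝ) ha'.le a).trans ?_
    have : Real.exp a = Real.exp 1 ^ a := by rw [← Real.exp_nat_mul, mul_one]
    rw [this]
    gcongr
    exact Real.exp_one_lt_d9.le.trans (by norm_num)
  have hf : (0 : ℝ) < a.factorial := by exact_mod_cast a.factorial_pos
  refine (Nat.choose_le_pow_div a n).trans ?_
  rw [div_pow, mul_pow, div_le_div_iff₀ hf (by positivity)]
  rw [div_le_iff₀ hf] at h1
  calc (n : ℝ) ^ a * a ^ a ≤ n ^ a * (3 ^ a * a.factorial) := by gcongr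
    _ = _ := by ring

lemma card_filter_forall_mem {I Q : Type*} [Fintype I] [Fintype Q] [DecidableEq I]
    [DecidableEq Q] [Nonempty Q] (S : Finset I) (B : Finset Q) :
    (#(univ.filter fun φ : I → Q => ∀ i ∈ S, φ i ∈ B) : ℝ) =
      (Fintype.card Q : ℝ) ^ Fintype.card I * ((#B : ℝ) / Fintype.card Q) ^ #S := by
  have h : (univ.filter fun φ : I → Q => ∀ i ∈ S, φ i ∈ B) =
      Fintype.piFinset fun i => if i ∈ S then B else univ := by
    ext φ
    simp only [mem_filter, mem_univ, true_and, Fintype.mem_piFinset]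
    refine forall_congr' fun i => ?_
    split_ifs with hi <;> simp [hi]
  have hQ : (0 : ℝ) < Fintype.card Q := by exact_mod_cast Fintype.card_pos
  rw [h, Fintype.card_piFinset]
  have h2 : ∀ i, #(if i ∈ S then B else univ) = if i ∈ S then #B else Fintype.card Q := by
    intro i; split_ifs <;> simp
  simp only [h2]
  rw [prod_ite, prod_const, prod_const]
  have h3 : #(univ.filter fun i => i ∈ S) = #S := by simp
  have h4 : #(univ.filter fun i => i ∉ S) = Fintype.card I - #S := by
    rw [← card_compl]; congr 1; ext; simp
  rw [h3, h4, div_pow]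
  push_cast
  have h5 : (Fintype.card Q : ℝ) ^ Fintype.card I =
      (Fintype.card Q : ℝ) ^ (Fintype.card I - #S) * (Fintype.card Q : ℝ) ^ #S := by
    rw [← pow_add, Nat.sub_add_cancel (card_le_univ S)]
  rw [h5]
  field_simp

lemma sum_quarter_pow_le (M : ℕ) : ∑ a ∈ range M, (1 / 4 : ℝ) ^ (a + 1) ≤ 1 / 3 := by
  have : ∑ a ∈ range M, (1 / 4 : ℝ) ^ (a + 1) = (1 - (1 / 4) ^ M) / 3 := by
    induction M with
    | zero => simp
    | succ M ih => rw [sum_range_succ, ih]; ring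
  rw [this]
  have : (0 : ℝ) ≤ (1 / 4) ^ M := by positivity
  linarith

/-- A random assignment of twenty neighbours to each element is expanding and has small
in-degrees. -/
lemma exists_expander {P Q : Type*} [Fintype P] [Fintype Q] [DecidableEq P] [DecidableEq Q]
    [Nonempty Q] (hPQ : Fintype.card P ≤ 2 * Fintype.card Q) (t : ℕ) (ht : 240 ≤ t)
    (htQ : 2 * Fintype.card Q ≤ 2 ^ t) :
    ∃ f : P → Finset Q, (∀ x, #(f x) ≤ 20) ∧
      (∀ A : Finset P, 4 * #A ≤ 3 * Fintype.card Q → #A ≤ #(A.biUnion f)) ∧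
      ∀ y, #(univ.filter fun x => y ∈ f x) ≤ t := by
  set p := Fintype.card P with hp
  set q := Fintype.card Q with hq
  have hq0 : (0 : ℝ) < q := by exact_mod_cast Fintype.card_pos
  have hPQ' : (p : ℝ) ≤ 2 * q := by exact_mod_cast hPQ
  let I := P × Fin 20
  have hI : Fintype.card I = p * 20 := by simp [I, hp]
  let ev : Finset I → Finset Q → Finset (I → Q) := fun S B => univ.filter fun φ => ∀ i ∈ S, φ i ∈ B
  have hev : ∀ S B, (#(ev S B) : ℝ) =
      (q : ℝ) ^ Fintype.card I * ((#B : ℝ) / q) ^ #S := fun S B => by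
    rw [hq, ← card_filter_forall_mem]
  have hmem : ∀ S B φ, φ ∈ ev S B ↔ ∀ i ∈ S, φ i ∈ B := fun S B φ => by simp [ev]
  clear_value ev
  by_contra! hcon
  have hcover : (univ : Finset (I → Q)) ⊆
      ((range (3 * q / 4)).biUnion fun a => (powersetCard (a + 1) (univ : Finset P)).biUnion
        fun A => (powersetCard (a + 1) (univ : Finset Q)).biUnion fun B =>
          ev (A ×ˢ univ) B) ∪
      (univ : Finset Q).biUnion fun y => (powersetCard t (univ : Finset I)).biUnion fun S =>
          ev S {y} := by
    intro φ _
    by_cases hexp : ∀ A : Finset P, 4 * #A ≤ 3 * q →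
      #A ≤ #(A.biUnion fun x => univ.image fun s => φ (x, s))
    · obtain ⟨y, hy⟩ := hcon (fun x => univ.image fun s => φ (x, s))
        (fun x => card_image_le.trans (by simp)) hexp
      have h1 : t ≤ #(univ.filter fun i => φ i = y) := by
        refine hy.le.trans ?_
        refine (card_le_card ?_).trans (card_image_le (f := Prod.fst))
        intro x hx
        obtain ⟨s, -, hs⟩ := mem_image.1 (mem_filter.1 hx).2
        exact mem_image.2 ⟨(x, s), by simpa using hs, rfl⟩
      obtain ⟨S, hS, hSc⟩ := exists_subset_card_eq h1
      refine mem_union_right _ (mem_biUnion.2 ⟨y, mem_univ _, mem_biUnion.2 ⟨S, ?_, ?_⟩⟩)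
      · simp [hSc]
      · rw [hmem]
        simp only [mem_singleton]
        exact fun i hi => (mem_filter.1 (hS hi)).2
    · push Not at hexp
      obtain ⟨A, hA, hAc⟩ := hexp
      have hA0 : 0 < #A := by omega
      obtain ⟨B, hB, -, hBc⟩ := exists_subsuperset_card_eq
        (subset_univ (A.biUnion fun x => univ.image fun s => φ (x, s))) hAc.le
        (by rw [card_univ]; omega)
      refine mem_union_left _ (mem_biUnion.2 ⟨#A - 1, by rw [mem_range]; omega,
        mem_biUnion.2 ⟨A, by simp; omega, mem_biUnion.2 ⟨B, by simp; omega, ?_⟩⟩⟩)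
      exact (hmem _ _ _).2 fun i hi => hB (mem_biUnion.2 ⟨i.1, (mem_product.1 hi).1, mem_image_of_mem _ (mem_univ i.2)⟩)
  have hcard := card_le_card hcover
  have hcard2 : (#(univ : Finset (I → Q)) : ℝ) ≤
      ∑ a ∈ range (3 * q / 4), ∑ A ∈ powersetCard (a + 1) (univ : Finset P),
        ∑ B ∈ powersetCard (a + 1) (univ : Finset Q),
          (#(ev (A ×ˢ univ) B) : ℝ) +
      ∑ y : Q, ∑ S ∈ powersetCard t (univ : Finset I),
          (#(ev S {y}) : ℝ) := by
    have : #(univ : Finset (I → Q)) ≤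
      ∑ a ∈ range (3 * q / 4), ∑ A ∈ powersetCard (a + 1) (univ : Finset P),
        ∑ B ∈ powersetCard (a + 1) (univ : Finset Q),
          #(ev (A ×ˢ univ) B) +
      ∑ y : Q, ∑ S ∈ powersetCard t (univ : Finset I),
          #(ev S {y}) :=
      hcard.trans ((card_union_le _ _).trans (Nat.add_le_add
        (card_biUnion_le.trans (sum_le_sum fun a _ => card_biUnion_le.trans
          (sum_le_sum fun A _ => card_biUnion_le)))
        (card_biUnion_le.trans (sum_le_sum fun a _ => card_biUnion_le))))
    exact_mod_cast this
  simp only [hev] at hcard2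
  rw [card_univ, Fintype.card_fun, ← hq] at hcard2
  push_cast at hcard2
  set Φ : ℝ := (q : ℝ) ^ Fintype.card I with hΦ
  have hΦ0 : 0 < Φ := by positivity
  have hfirst : ∀ a ∈ range (3 * q / 4), ∑ A ∈ powersetCard (a + 1) (univ : Finset P),
        ∑ B ∈ powersetCard (a + 1) (univ : Finset Q),
          Φ * ((#B : ℝ) / q) ^ #(A ×ˢ (univ : Finset (Fin 20))) ≤ Φ * (1 / 4) ^ (a + 1) := by
    intro a ha
    have h1 : ∀ A ∈ powersetCard (a + 1) (univ : Finset P),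
        ∑ B ∈ powersetCard (a + 1) (univ : Finset Q),
          Φ * ((#B : ℝ) / q) ^ #(A ×ˢ (univ : Finset (Fin 20))) =
        q.choose (a + 1) * (Φ * (((a + 1 : ℕ) : ℝ) / q) ^ ((a + 1) * 20)) := by
      intro A hA
      rw [sum_congr rfl fun B hB => by
        rw [(mem_powersetCard.1 hB).2, card_product, (mem_powersetCard.1 hA).2], sum_const,
        card_powersetCard]
      simp [hq]
    rw [sum_congr rfl h1, sum_const, card_powersetCard, card_univ, nsmul_eq_mul, ← hp]
    set b := a + 1 with hb
    have hb0 : (0 : ℝ) < b := by positivity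
    have hbq : (b : ℝ) / q ≤ 3 / 4 := by
      rw [div_le_div_iff₀ hq0 (by norm_num)]
      rw [mem_range] at ha
      exact_mod_cast (by omega : b * 4 ≤ 3 * q)
    have h2 : (p.choose b : ℝ) ≤ (6 * q / b) ^ b := by
      refine (choose_le_three_mul_div_pow p b (by omega)).trans ?_
      refine pow_le_pow_left₀ (by positivity) (div_le_div_of_nonneg_right ?_ hb0.le) _
      linarith
    have h3 := choose_le_three_mul_div_pow q b (by omega)
    calc (p.choose b : ℝ) * (q.choose b * (Φ * ((b : ℝ) / q) ^ (b * 20)))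
        ≤ (6 * q / b) ^ b * ((3 * q / b) ^ b * (Φ * ((b : ℝ) / q) ^ (b * 20))) := by gcongr
      _ = Φ * (18 * ((b : ℝ) / q) ^ 18) ^ b := by
          rw [mul_comm b 20, pow_mul]
          have : (6 * q / b : ℝ) * (3 * q / b) * ((b : ℝ) / q) ^ 20 = 18 * ((b : ℝ) / q) ^ 18 := by
            field_simp; ring
          rw [← this, mul_pow, mul_pow]; ring
      _ ≤ Φ * (1 / 4) ^ b := by
          gcongr
          calc 18 * ((b : ℝ) / q) ^ 18 ≤ 18 * (3 / 4) ^ 18 := by gcongr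
            _ ≤ 1 / 4 := by norm_num
  have hsecond : ∑ y : Q, ∑ S ∈ powersetCard t (univ : Finset I),
      Φ * ((#({y} : Finset Q) : ℝ) / q) ^ #S ≤ Φ * (1 / 2) := by
    have h1 : ∀ y : Q, ∑ S ∈ powersetCard t (univ : Finset I),
        Φ * ((#({y} : Finset Q) : ℝ) / q) ^ #S = (p * 20).choose t * (Φ * (1 / q) ^ t) := by
      intro y
      rw [sum_congr rfl fun B hB => by rw [(mem_powersetCard.1 hB).2], sum_const,
        card_powersetCard, card_univ, hI]
      simp
    rw [sum_congr rfl fun y _ => h1 y, sum_const, card_univ, nsmul_eq_mul, ← hq]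
    have ht0 : (0 : ℝ) < t := by exact_mod_cast (by omega : 0 < t)
    have ht' : (240 : ℝ) ≤ t := by exact_mod_cast ht
    have h2 : ((p * 20).choose t : ℝ) ≤ (q / 2) ^ t := by
      refine (choose_le_three_mul_div_pow _ t (by omega)).trans ?_
      refine pow_le_pow_left₀ (by positivity) ?_ _
      rw [div_le_div_iff₀ ht0 (by norm_num)]
      push_cast
      nlinarith
    have h3 : 2 * (q : ℝ) ≤ 2 ^ t := by exact_mod_cast htQ
    calc (q : ℝ) * ((p * 20).choose t * (Φ * (1 / q) ^ t))
        ≤ q * ((q / 2) ^ t * (Φ * (1 / q) ^ t)) := by gcongr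
      _ = Φ * (q / 2 ^ t) := by
          have : ((q : ℝ) / 2) ^ t * (1 / q) ^ t = 1 / 2 ^ t := by
            rw [← mul_pow, ← one_div_pow]; congr 1; field_simp
          rw [show (q : ℝ) * ((q / 2) ^ t * (Φ * (1 / q) ^ t)) =
            q * Φ * ((q / 2) ^ t * (1 / q) ^ t) by ring, this]
          ring
      _ ≤ Φ * (1 / 2) := by
          refine mul_le_mul_of_nonneg_left ?_ hΦ0.le
          rw [div_le_div_iff₀ (by positivity) (by norm_num)]
          linarith
  have h4 := sum_le_sum hfirst
  rw [← mul_sum] at h4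
  have h5 := mul_le_mul_of_nonneg_left (sum_quarter_pow_le (3 * q / 4)) hΦ0.le
  linarith

/-- A sparse bipartite graph between `Fin (3 * m)` and `Fin (2 * m) ⊕ Fin (2 * m)` which has a
perfect matching whenever half of the first summand is deleted. -/
lemma exists_template (m t : ℕ) (hm : 2 ≤ m) (ht : 240 ≤ t) (hmt : 6 * m ≤ 2 ^ t) :
    ∃ N : Fin (3 * m) → Finset (Fin (2 * m) ⊕ Fin (2 * m)),
      ∑ z, #(N z) ≤ 140 * m ∧ (∀ z, #(N z) ≤ t + 20) ∧
      (∀ w, #(univ.filter fun z => w ∈ N z) ≤ t + 20) ∧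
      ∀ X : Finset (Fin (2 * m)), #X = m →
        ∃ f : Fin (3 * m) → Fin (2 * m) ⊕ Fin (2 * m), Function.Injective f ∧
          (∀ z, f z ∈ N z) ∧ univ.image f = X.disjSum univ := by
  have : Nonempty (Fin (2 * m)) := ⟨⟨0, by omega⟩⟩
  have : Nonempty (Fin (3 * m)) := ⟨⟨0, by omega⟩⟩
  obtain ⟨f, hf1, hf2, hf3⟩ := exists_expander (P := Fin (3 * m)) (Q := Fin (2 * m))
    (by simp; omega) t ht (by simp; omega)
  obtain ⟨g, hg1, hg2, hg3⟩ := exists_expander (P := Fin (2 * m) ⊕ Fin (2 * m))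
    (Q := Fin (3 * m)) (by simp; omega) t ht (by simp; omega)
  simp only [Fintype.card_fin] at hf2 hg2
  have hgsum : ∑ z, #(univ.filter fun w => z ∈ g w) ≤ 80 * m := by
    calc ∑ z, #(univ.filter fun w => z ∈ g w) = ∑ w, #(g w) := by
          simp only [card_filter]
          rw [sum_comm]
          refine sum_congr rfl fun w _ => ?_
          simp
      _ ≤ ∑ w : Fin (2 * m) ⊕ Fin (2 * m), 20 := sum_le_sum fun w _ => hg1 w
      _ = 80 * m := by simp; ring
  refine ⟨fun z => (f z).map Function.Embedding.inr ∪ univ.filter fun w => z ∈ g w, ?_, ?_, ?_, ?_⟩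
  · calc ∑ z, #((f z).map Function.Embedding.inr ∪ univ.filter fun w => z ∈ g w)
        ≤ ∑ z, (20 + #(univ.filter fun w => z ∈ g w)) := sum_le_sum fun z _ =>
          (card_union_le _ _).trans (Nat.add_le_add_right (by simpa using hf1 z) _)
      _ ≤ 140 * m := by
          rw [sum_add_distrib, sum_const]
          simp
          omega
  · intro z
    refine (card_union_le _ _).trans ?_
    have := hg3 z
    have := hf1 z
    rw [card_map]
    omega
  · intro w
    have h1 : (univ.filter fun z => w ∈ (f z).map Function.Embedding.inr ∪
        univ.filter fun w => z ∈ g w) ⊆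
        (univ.filter fun z => w ∈ (f z).map Function.Embedding.inr) ∪ g w := by
      intro z hz
      have := (mem_filter.1 hz).2
      rcases mem_union.1 this with h | h
      · exact mem_union_left _ (mem_filter.2 ⟨mem_univ _, h⟩)
      · exact mem_union_right _ (mem_filter.1 h).2
    refine (card_le_card h1).trans ((card_union_le _ _).trans (Nat.add_le_add ?_ (hg1 w)))
    rcases w with w | w
    · simp
    · simpa using hf3 w
  · intro X hX
    set B : Finset (Fin (2 * m) ⊕ Fin (2 * m)) := X.disjSum univ with hB
    have hBc : #B = 3 * m := by rw [hB, card_disjSum, hX]; simp; omega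
    set N' : Fin (3 * m) → Finset (Fin (2 * m) ⊕ Fin (2 * m)) := fun z =>
      ((f z).map Function.Embedding.inr ∪ univ.filter fun w => z ∈ g w) ∩ B with hN'
    have hall : ∀ A : Finset (Fin (3 * m)), #A ≤ #(A.biUnion N') := by
      intro A
      by_cases hA : 4 * #A ≤ 3 * (2 * m)
      · refine (hf2 A hA).trans ?_
        rw [← card_map Function.Embedding.inr]
        refine card_le_card fun w hw => ?_
        obtain ⟨y, hy, rfl⟩ := mem_map.1 hw
        obtain ⟨z, hz, hyz⟩ := mem_biUnion.1 hy
        refine mem_biUnion.2 ⟨z, hz, mem_inter.2 ⟨mem_union_left _ (mem_map_of_mem _ hyz), ?_⟩⟩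
        simp [hB]
      · by_contra! hlt
        have hAle : #A ≤ 3 * m := by simpa using card_le_univ A
        have h1 : 3 * m - #A + 1 ≤ #(B \ A.biUnion N') := by
          have := le_card_sdiff (A.biUnion N') B
          omega
        obtain ⟨C, hC, hCc⟩ := exists_subset_card_eq h1
        have h2 := hg2 C (by omega)
        have h3 : C.biUnion g ⊆ Aᶜ := by
          intro z hz
          obtain ⟨w, hw, hzw⟩ := mem_biUnion.1 hz
          rw [mem_compl]
          intro hzA
          obtain ⟨hwB, hwN⟩ := mem_sdiff.1 (hC hw)
          exact hwN (mem_biUnion.2 ⟨z, hzA, mem_inter.2 ⟨mem_union_right _ (by simpa using hzw),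
            hwB⟩⟩)
        have h4 := card_le_card h3
        rw [card_compl, Fintype.card_fin] at h4
        omega
    obtain ⟨F, hF1, hF2⟩ := (all_card_le_biUnion_card_iff_exists_injective N').1 hall
    refine ⟨F, hF1, fun z => (mem_inter.1 (hF2 z)).1, ?_⟩
    refine eq_of_subset_of_card_le ?_ ?_
    · intro w hw
      obtain ⟨z, -, rfl⟩ := mem_image.1 hw
      exact (mem_inter.1 (hF2 z)).2
    · rw [card_image_of_injective _ hF1, hBc]; simp

end Template

section Covering

variable {V : Type} [DecidableEq V] {G : SimpleGraph V} {q r : ℕ} {e : ℝ}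

lemma CliqueProp.exists_disjoint_cliques {ι : Type*} [DecidableEq ι] (h : CliqueProp G q e)
    (hq : q + 1 = r) (J : Finset ι) (x : ι → V) (A : ι → Finset V)
    (hA : ∀ i ∈ J, e + q * #J ≤ (#((A i).filter (G.Adj (x i))) : ℝ)) :
    ∃ T : ι → Finset V, (∀ i ∈ J, T i ⊆ A i ∧ #(T i) = q ∧ G.IsNClique r (insert (x i) (T i))) ∧
      ∀ i ∈ J, ∀ j ∈ J, i ≠ j → Disjoint (T i) (T j) := by
  induction J using Finset.induction_on with
  | empty => exact ⟨fun _ => ∅, by simp, by simp⟩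
  | insert a J ha ih =>
    rw [card_insert_of_notMem ha] at hA
    push_cast at hA
    have hq0 : (0 : ℝ) ≤ q := q.cast_nonneg
    obtain ⟨T, hT, hTT⟩ := ih fun i hi => by
      have := hA i (mem_insert_of_mem hi)
      linarith
    have hB : #(J.biUnion T) ≤ #J * q := card_biUnion_le_card_mul _ _ _ fun i hi => (hT i hi).2.1.le
    have hB' : (#(J.biUnion T) : ℝ) ≤ #J * q := by exact_mod_cast hB
    obtain ⟨S, hS, hSd, hSc, hSq⟩ := h.exists_clique (v := x a) (X := A a) (A := J.biUnion T) (by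
      have := hA a (mem_insert_self _ _)
      linarith)
    rw [disjoint_biUnion_right] at hSd
    have hne : ∀ i ∈ J, i ≠ a := fun i hi h => ha (h ▸ hi)
    refine ⟨Function.update T a S, fun i hi => ?_, fun i hi j hj hij => ?_⟩
    · rcases mem_insert.1 hi with rfl | hi
      · simpa [hq] using ⟨hS, hSc, hq ▸ hSq⟩
      · simpa [hne i hi] using hT i hi
    · rcases mem_insert.1 hi with rfl | hi <;> rcases mem_insert.1 hj with rfl | hj
      · exact absurd rfl hij
      · simpa [hne j hj] using hSd j hj
      · have hi' := (mem_insert.1 hi).resolve_left hij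
        simpa [hij] using (hSd i hi').symm
      · simpa [hne i hi, hne j hj] using hTT i hi j hj hij

lemma CliqueProp.exists_cover (h : CliqueProp G q e) (hq : q + 1 = r) {L A : Finset V}
    (hLA : Disjoint L A) (hA : ∀ v ∈ L, e + q * #L ≤ (#(A.filter (G.Adj v)) : ℝ)) :
    ∃ Q ⊆ A, #Q ≤ q * #L ∧ HasKrFactorOn G r (L ∪ Q) := by
  obtain ⟨T, hT, hTT⟩ := h.exists_disjoint_cliques hq L id (fun _ => A) hA
  have hTA : ∀ v ∈ L, ∀ w ∈ L, w ∉ T v := fun v hv w hw h =>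
    disjoint_left.1 hLA hw ((hT v hv).1 h)
  refine ⟨L.biUnion T, biUnion_subset.2 fun v hv => (hT v hv).1, ?_, ?_⟩
  · rw [mul_comm]
    exact card_biUnion_le_card_mul _ _ _ fun i hi => (hT i hi).2.1.le
  · have : L ∪ L.biUnion T = L.biUnion fun v => insert v (T v) := by
      ext w
      simp only [mem_union, mem_biUnion, mem_insert]
      constructor
      · rintro (hw | ⟨v, hv, hw⟩)
        exacts [⟨w, hw, Or.inl rfl⟩, ⟨v, hv, Or.inr hw⟩]
      · rintro ⟨v, hv, rfl | hw⟩
        exacts [Or.inl hv, Or.inr ⟨v, hv, hw⟩]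
    rw [this]
    refine HasKrFactorOn.biUnion _ _ (fun v hv => .of_isNClique (hT v hv).2.2)
      fun v hv w hw hvw => ?_
    rw [disjoint_insert_left, disjoint_insert_right, mem_insert, not_or]
    exact ⟨⟨hvw, hTA w hw v hv⟩, hTA v hv w hw, hTT v hv w hw hvw⟩

lemma DegProp.exists_almost_cover {b : ℕ} {y p a : ℝ} (hD : DegProp G b y p) (hb : 0 < b)
    (hC : CliqueProp G q e) (hq : q + 1 = r) (hp : 0 ≤ p) (hy : y ≤ a) (ha : e ≤ a * p / 2)
    {L A : Finset V} (hLA : Disjoint L A) (hA : a + q * #L ≤ (#A : ℝ)) :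
    ∃ L' ⊆ L, #L' < b ∧ ∃ Q ⊆ A, #Q ≤ q * #L ∧ HasKrFactorOn G r ((L \ L') ∪ Q) := by
  induction hn : #L generalizing L A with
  | zero => exact ⟨L, subset_rfl, by omega, ∅, by simp, by simp, by simpa using hasKrFactorOn_empty⟩
  | succ k ih =>
    by_cases hLb : #L < b
    · exact ⟨L, subset_rfl, hLb, ∅, by simp, by simp, by simpa using hasKrFactorOn_empty⟩
    have haA : a ≤ (#A : ℝ) := le_trans (by
      have : (0 : ℝ) ≤ q * #L := by positivity
      linarith) hA
    obtain ⟨v, hv, hvA⟩ := hD L A hLA (by omega) (hy.trans haA)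
    obtain ⟨S, hS, -, hSc, hSq⟩ := hC.exists_clique (v := v) (X := A) (A := ∅) (by
      have : a * p ≤ #A * p := by gcongr
      simp only [card_empty, CharP.cast_eq_zero, add_zero]
      linarith)
    have hAS : #(A \ S) + q = #A := by rw [← hSc]; exact card_sdiff_add_card_eq_card hS
    have hAS' : (#(A \ S) : ℝ) + q = #A := by exact_mod_cast hAS
    have hLc : #(L.erase v) = k := by rw [card_erase_of_mem hv]; omega
    obtain ⟨L', hL', hL'b, Q, hQ, hQc, hF⟩ := ih (L := L.erase v) (A := A \ S)
      (disjoint_of_subset_left (erase_subset _ _) (disjoint_of_subset_right sdiff_subset hLA))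
      (by
        rw [hn] at hA
        rw [hLc]
        push_cast at hA
        linarith) hLc
    have hvL' : v ∉ L' := fun h => (mem_erase.1 (hL' h)).1 rfl
    have hdis : Disjoint (L.erase v \ L' ∪ Q) (insert v S) := by
      rw [disjoint_insert_right, disjoint_union_left]
      refine ⟨?_, ?_, ?_⟩
      · simp only [mem_union, mem_sdiff, mem_erase, ne_eq, not_true, false_and, false_or]
        exact fun h => disjoint_left.1 hLA hv (mem_sdiff.1 (hQ h)).1
      · exact disjoint_of_subset_left (sdiff_subset.trans (erase_subset _ _))
          (disjoint_of_subset_right hS hLA)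
      · exact disjoint_of_subset_left hQ sdiff_disjoint
    refine ⟨L', hL'.trans (erase_subset _ _), hL'b, Q ∪ S, union_subset
      (hQ.trans sdiff_subset) hS, ?_, ?_⟩
    · refine (card_union_le _ _).trans ?_
      rw [hSc, mul_add]
      omega
    · have : L \ L' ∪ (Q ∪ S) = (L.erase v \ L' ∪ Q) ∪ insert v S := by
        ext w
        simp only [mem_union, mem_sdiff, mem_erase, mem_insert]
        by_cases hw : w = v
        · subst hw; simp [hv, hvL']
        · simp only [hw, ne_eq, not_false_eq_true, true_and, false_or]; tauto
      rw [this]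
      exact hF.union (.of_isNClique (hq ▸ hSq)) hdis

lemma SwitchProp.exists_clique {m : ℕ} (h : SwitchProp G r m) {U : Finset V}
    (hU : (r + 1) * m ≤ #U) : ∃ S ⊆ U, G.IsNClique r S := by
  obtain ⟨P, hP, hPU, hPc⟩ := exists_disjoint_family (r + 1) m U hU
  obtain ⟨i, j, -, a, -, b, -, E, hE, -, -, -, hEa, -⟩ := h P hP fun i => (hPc i).ge
  exact ⟨E.erase a, (erase_subset _ _).trans (hE.trans (biUnion_subset.2 fun i _ => hPU i)), hEa⟩

lemma SwitchProp.exists_disjoint_cliques {m : ℕ} (h : SwitchProp G r m) (k : ℕ) {U : Finset V}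
    (hU : (r + 1) * m + k * r ≤ #U) : ∃ R ⊆ U, #R = k * r ∧ HasKrFactorOn G r R := by
  induction k with
  | zero => exact ⟨∅, by simp, by simp, hasKrFactorOn_empty⟩
  | succ k ih =>
    have hk : (k + 1) * r = k * r + r := by ring
    rw [hk] at hU
    obtain ⟨R, hR, hRc, hF⟩ := ih (by omega)
    obtain ⟨S, hS, hSc⟩ := h.exists_clique (U := U \ R) (by
      have := le_card_sdiff R U
      omega)
    have hdis : Disjoint R S := (disjoint_of_subset_left hS sdiff_disjoint).symm
    refine ⟨R ∪ S, union_subset hR (hS.trans sdiff_subset), ?_, hF.union (.of_isNClique hSc) hdis⟩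
    rw [card_union_of_disjoint hdis, hRc, hSc.card_eq]
    ring

lemma SwitchProp.exists_tiling {m : ℕ} (h : SwitchProp G r m) (hr : 0 < r)
    (U : Finset V) : ∃ L ⊆ U, #L < (r + 1) * m ∧ HasKrFactorOn G r (U \ L) := by
  induction U using Finset.strongInduction with
  | H U ih =>
    by_cases hU : #U < (r + 1) * m
    · exact ⟨U, subset_rfl, hU, by simpa using hasKrFactorOn_empty⟩
    obtain ⟨S, hS, hSc⟩ := h.exists_clique (not_lt.1 hU)
    have hS0 : S.Nonempty := by rw [← card_pos, hSc.card_eq]; exact hr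
    obtain ⟨L, hL, hLc, hF⟩ := ih (U \ S) (sdiff_ssubset hS hS0)
    refine ⟨L, hL.trans sdiff_subset, hLc, ?_⟩
    have : U \ L = (U \ S) \ L ∪ S := by
      ext w
      have h1 := @hS w
      have h2 : w ∈ L → w ∉ S := fun h => (mem_sdiff.1 (hL h)).2
      simp only [mem_union, mem_sdiff]
      tauto
    rw [this]
    exact hF.union (.of_isNClique hSc) (disjoint_of_subset_left sdiff_subset sdiff_disjoint)

end Covering
section Hubs

variable {V : Type} [Fintype V] [DecidableEq V]

/-- Outside any small set `W`, any two vertices with many neighbours outside `W` are joined by a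
small switch. -/
def ReachProp (G : SimpleGraph V) (r C w : ℕ) (d : ℝ) : Prop :=
  ∀ (W : Finset V) (x x' : V), #W ≤ w → x ∉ W → x' ∉ W →
    d ≤ (#(Wᶜ.filter (G.Adj x)) : ℝ) → d ≤ (#(Wᶜ.filter (G.Adj x')) : ℝ) → Reach G r C W x x'

variable {G : SimpleGraph V} {q r C w b Δ K : ℕ} {e d : ℝ}

lemma ReachProp.exists_hub {ι : Type*} [DecidableEq ι] (hR : ReachProp G r C w d)
    (hC : CliqueProp G q e) (hq : q + 1 = r) {U A B : Finset V}
    (hB : ∀ v ∉ B, d + K ≤ (#((U ∪ A)ᶜ.filter (G.Adj v)) : ℝ)) (hBb : #B ≤ b)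
    (hw : #(U ∪ A) + K ≤ w) (J : Finset ι) (ξ : ι → V) (hξ : ∀ i ∈ J, ξ i ∈ U) (hJ : #J ≤ Δ)
    (hK : (q + 2) * (Δ * (C + 3)) ≤ K) (hd : e + b + q * Δ ≤ d + K)
    (hA : ∀ i ∈ J, e + b + q * Δ ≤ (#((A \ U).filter (G.Adj (ξ i))) : ℝ)) :
    ∃ D, Disjoint D U ∧ #D ≤ q * (1 + #J * C) ∧ #(D ∩ A) ≤ q * #(J.filter fun i => ξ i ∈ B) ∧
      ∀ i ∈ J, HasKrFactorOn G r (insert (ξ i) D) := by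
  rcases J.eq_empty_or_nonempty with rfl | hJ0
  · exact ⟨∅, by simp, by simp, by simp, by simp⟩
  have hqJ : (q : ℝ) * #J ≤ q * Δ := by gcongr
  have hBb' : (#B : ℝ) ≤ b := by exact_mod_cast hBb
  have hsd : ∀ (Z : Finset V) (v : V),
      (#(Z.filter (G.Adj v)) : ℝ) - b ≤ #((Z \ B).filter (G.Adj v)) := by
    intro Z v
    have h1 : #(Z.filter (G.Adj v)) ≤ #((Z \ B).filter (G.Adj v)) + #B := by
      refine le_trans (card_le_card fun u hu => ?_) (card_union_le _ _)
      simp only [mem_union, mem_filter, mem_sdiff] at hu ⊢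
      tauto
    have h2 : (#(Z.filter (G.Adj v)) : ℝ) ≤ #((Z \ B).filter (G.Adj v)) + #B := by
      exact_mod_cast h1
    linarith
  obtain ⟨T, hT, hTT⟩ := hC.exists_disjoint_cliques hq J ξ
    (fun i => (if ξ i ∈ B then A \ U else (U ∪ A)ᶜ) \ B) fun i hi => by
      refine le_trans ?_ (hsd _ _)
      split_ifs with h
      · linarith [hA i hi]
      · linarith [hB _ h]
  have hTB : ∀ i ∈ J, ∀ v ∈ T i, v ∉ B := fun i hi v hv => (mem_sdiff.1 ((hT i hi).1 hv)).2
  have hTU : ∀ i ∈ J, ∀ v ∈ T i, v ∉ U := fun i hi v hv => by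
    have := (mem_sdiff.1 ((hT i hi).1 hv)).1
    split_ifs at this
    · exact (mem_sdiff.1 this).2
    · simp only [mem_compl, mem_union, not_or] at this
      exact this.1
  have hTA : ∀ i ∈ J, ∀ v ∈ T i, v ∈ A → ξ i ∈ B := fun i hi v hv hvA => by
    have := (mem_sdiff.1 ((hT i hi).1 hv)).1
    by_contra h
    simp [h, hvA] at this
  set W := U ∪ (A \ J.biUnion T) with hW
  have hWUA : W ⊆ U ∪ A := union_subset_union_right sdiff_subset
  obtain ⟨D, hDW, hDc, hD⟩ := exists_hub_set (G := G) (r := r) (K := K) (c := C) (q := q)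
    (W := W) (S := Wᶜ \ B) (fun y hy y' hy' W' hW' hyW' hyW'' => by
      have hdeg : ∀ y ∈ Wᶜ \ B, d ≤ (#((W ∪ W')ᶜ.filter (G.Adj y)) : ℝ) := by
        intro y hy
        have h1 := hB y (mem_sdiff.1 hy).2
        have h2 : #((U ∪ A)ᶜ.filter (G.Adj y)) ≤ #((W ∪ W')ᶜ.filter (G.Adj y)) + #W' := by
          refine le_trans (card_le_card fun u hu => ?_) (card_union_le _ _)
          have := @hWUA u
          simp only [mem_union, mem_filter, mem_compl] at hu this ⊢
          tauto
        have h3 : (#((U ∪ A)ᶜ.filter (G.Adj y)) : ℝ) ≤ #((W ∪ W')ᶜ.filter (G.Adj y)) + K := by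
          exact_mod_cast h2.trans (Nat.add_le_add_left hW' _)
        linarith
      have hnot : ∀ y ∈ Wᶜ \ B, y ∉ W := fun y hy => by simpa using (mem_sdiff.1 hy).1
      refine hR (W ∪ W') y y' ?_ ?_ ?_ (hdeg y hy) (hdeg y' hy')
      · exact (card_union_le _ _).trans ((Nat.add_le_add (card_le_card hWUA) hW').trans hw)
      · simp [hnot y hy, hyW']
      · simp [hnot y' hy', hyW''])
    (disjoint_of_subset_left sdiff_subset disjoint_compl_left) J hJ0 ξ T ∅
    (fun i hi v hv => by
      have h1 : v ∈ J.biUnion T := mem_biUnion.2 ⟨i, hi, hv⟩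
      simp [hW, hTU i hi v hv, hTB i hi v hv, h1, -mem_biUnion])
    (by simp) hTT (fun i hi j hj h => hTU j hj _ h (hξ i hi)) (fun i hi => (hT i hi).2.1)
    (fun i hi => (hT i hi).2.2) (by
      simp only [card_empty, zero_add]
      refine le_trans ?_ hK
      gcongr)
  rw [union_empty] at hDW
  refine ⟨D, disjoint_of_subset_right subset_union_left hDW, hDc, ?_, fun i hi => (hD i hi).2⟩
  rw [mul_comm q]
  refine le_trans (card_le_card (t := (J.filter fun i => ξ i ∈ B).biUnion T) fun v hv => ?_)
    (card_biUnion_le_card_mul _ _ _ fun i hi => (hT i (mem_filter.1 hi).1).2.1.le)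
  obtain ⟨hvD, hvA⟩ := mem_inter.1 hv
  have h1 := disjoint_left.1 hDW hvD
  have h2 : v ∈ J.biUnion T := by
    by_contra h
    exact h1 (mem_union_right _ (mem_sdiff.2 ⟨hvA, h⟩))
  obtain ⟨i, hi, hv⟩ := mem_biUnion.1 h2
  exact mem_biUnion.2 ⟨i, mem_filter.2 ⟨hi, hTA i hi v hv hvA⟩, hv⟩

/-- The vertices with few neighbours outside `W`. -/
noncomputable def lowVertices (G : SimpleGraph V) (d : ℝ) (W : Finset V) : Finset V :=
  univ.filter fun v => (#(Wᶜ.filter (G.Adj v)) : ℝ) < d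

lemma lowVertices_mono {W W' : Finset V} (h : W ⊆ W') :
    lowVertices G d W ⊆ lowVertices G d W' := by
  intro v hv
  simp only [lowVertices, mem_filter, mem_univ, true_and] at hv ⊢
  refine lt_of_le_of_lt ?_ hv
  exact_mod_cast card_le_card (filter_subset_filter _ (compl_subset_compl.2 h))

lemma ReachProp.exists_hubs {ι κ : Type} [Fintype ι] [DecidableEq ι] [Fintype κ] [DecidableEq κ]
    (hR : ReachProp G r C w d) (hC : CliqueProp G q e) (hq : q + 1 = r) {U A : Finset V}
    (N : κ → Finset ι) (ξ : ι → V) (hξ : Function.Injective ξ) (hξU : ∀ i, ξ i ∈ U)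
    (hw : #U + #A + ∑ z, q * (1 + #(N z) * C) + K ≤ w)
    (hlow : ∀ W : Finset V, #W ≤ w → #(lowVertices G (d + K) W) ≤ b)
    (hN : ∀ z, #(N z) ≤ Δ) (hN' : ∀ i, #(univ.filter fun z => i ∈ N z) ≤ Δ)
    (hK : (q + 2) * (Δ * (C + 3)) ≤ K) (hd : e + b + q * Δ ≤ d + K)
    (hA : ∀ i, e + b + q * Δ + q * (b * Δ) ≤ (#((A \ U).filter (G.Adj (ξ i))) : ℝ)) :
    ∃ D : κ → Finset V, (∀ z, Disjoint (D z) U ∧ #(D z) ≤ q * (1 + #(N z) * C) ∧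
        ∀ i ∈ N z, HasKrFactorOn G r (insert (ξ i) (D z))) ∧
      ∀ z z', z ≠ z' → Disjoint (D z) (D z') := by
  suffices h : ∀ s : Finset κ, ∃ D : κ → Finset V, (∀ z ∈ s, Disjoint (D z) U ∧
      #(D z) ≤ q * (1 + #(N z) * C) ∧ ∀ i ∈ N z, HasKrFactorOn G r (insert (ξ i) (D z))) ∧
      (∀ z ∈ s, ∀ z' ∈ s, z ≠ z' → Disjoint (D z) (D z')) ∧
      #(s.biUnion D ∩ A) ≤ ∑ z ∈ s,
        q * #((N z).filter fun i => ξ i ∈ lowVertices G (d + K) (U ∪ s.biUnion D ∪ A)) by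
    obtain ⟨D, h1, h2, -⟩ := h univ
    exact ⟨D, fun z => h1 z (mem_univ z), fun z z' => h2 z (mem_univ z) z' (mem_univ z')⟩
  have hsize : ∀ (s : Finset κ) (D : κ → Finset V), (∀ z ∈ s, #(D z) ≤ q * (1 + #(N z) * C)) →
      #(U ∪ s.biUnion D ∪ A) + K ≤ w := by
    intro s D hD
    have h1 : #(s.biUnion D) ≤ ∑ z, q * (1 + #(N z) * C) :=
      card_biUnion_le.trans ((sum_le_sum hD).trans (sum_le_sum_of_subset (subset_univ _)))
    have h2 := card_union_le (U ∪ s.biUnion D) A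
    have h3 := card_union_le U (s.biUnion D)
    omega
  intro s
  induction s using Finset.induction_on with
  | empty => exact ⟨fun _ => ∅, by simp, by simp, by simp⟩
  | insert a s ha ih =>
    obtain ⟨D, hD, hDD, hDA⟩ := ih
    have hsz := hsize s D fun z hz => (hD z hz).2.1
    set B := lowVertices G (d + K) (U ∪ s.biUnion D ∪ A) with hBdef
    have hBb : #B ≤ b := hlow _ (by omega)
    have hcount : ∑ z ∈ s, q * #((N z).filter fun i => ξ i ∈ B) ≤ q * (b * Δ) := by
      rw [← mul_sum]
      refine Nat.mul_le_mul_left _ ?_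
      calc ∑ z ∈ s, #((N z).filter fun i => ξ i ∈ B)
          ≤ ∑ z, #((N z).filter fun i => ξ i ∈ B) := sum_le_sum_of_subset (subset_univ _)
        _ = ∑ i ∈ univ.filter (fun i => ξ i ∈ B), #(univ.filter fun z => i ∈ N z) := by
            have h1 : ∀ z, (N z).filter (fun i => ξ i ∈ B) =
                (univ.filter fun i => ξ i ∈ B).filter fun i => i ∈ N z := by
              intro z; ext i; simp [and_comm]
            simp only [h1, card_filter _ (univ : Finset κ)]
            simp only [card_eq_sum_ones, sum_filter (s := filter _ _)]
            rw [sum_comm]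
        _ ≤ ∑ i ∈ univ.filter (fun i => ξ i ∈ B), Δ := sum_le_sum fun i _ => hN' i
        _ ≤ b * Δ := by
            rw [sum_const, smul_eq_mul]
            refine Nat.mul_le_mul_right _ (le_trans ?_ hBb)
            refine card_le_card_of_injOn ξ (fun i hi => ?_) hξ.injOn
            simpa using hi
    obtain ⟨E, hEU, hEc, hEA, hE⟩ := hR.exists_hub hC hq (U := U ∪ s.biUnion D) (A := A) (B := B)
      (b := b) (Δ := Δ) (K := K) (fun v hv => by simpa [hBdef, lowVertices] using hv) hBb hsz
      (N a) ξ (fun i _ => mem_union_left _ (hξU i)) (hN a) hK hd (fun i _ => by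
        have h1 : #((A \ U).filter (G.Adj (ξ i))) ≤
            #((A \ (U ∪ s.biUnion D)).filter (G.Adj (ξ i))) + #(s.biUnion D ∩ A) := by
          refine le_trans (card_le_card fun u hu => ?_) (card_union_le _ _)
          simp only [mem_union, mem_filter, mem_sdiff, mem_inter] at hu ⊢
          tauto
        have h2 : (#((A \ U).filter (G.Adj (ξ i))) : ℝ) ≤
            #((A \ (U ∪ s.biUnion D)).filter (G.Adj (ξ i))) + q * (b * Δ) := by
          exact_mod_cast h1.trans (Nat.add_le_add_left (hDA.trans hcount) _)
        linarith [hA i])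
    rw [disjoint_union_right, disjoint_biUnion_right] at hEU
    have hne : ∀ z ∈ s, z ≠ a := fun z hz h => ha (h ▸ hz)
    have hup : ∀ z ∈ s, Function.update D a E z = D z := fun z hz => by simp [hne z hz]
    have hbi : (insert a s).biUnion (Function.update D a E) = E ∪ s.biUnion D := by
      rw [biUnion_insert, Function.update_self, biUnion_congr rfl hup]
    have hmono : B ⊆ lowVertices G (d + K) (U ∪ (E ∪ s.biUnion D) ∪ A) :=
      lowVertices_mono (union_subset_union_left (union_subset_union_right subset_union_right))
    refine ⟨Function.update D a E, fun z hz => ?_, fun z hz z' hz' hzz' => ?_, ?_⟩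
    · rcases mem_insert.1 hz with rfl | hz
      · simpa using ⟨hEU.1, hEc, hE⟩
      · rw [hup z hz]; exact hD z hz
    · by_cases h : z = a
      · subst h
        have hz2 := (mem_insert.1 hz').resolve_left (Ne.symm hzz')
        rw [hup z' hz2, Function.update_self]
        exact hEU.2 z' hz2
      · have hz1 := (mem_insert.1 hz).resolve_left h
        by_cases h' : z' = a
        · subst h'
          rw [hup z hz1, Function.update_self]
          exact (hEU.2 z hz1).symm
        · have hz2 := (mem_insert.1 hz').resolve_left h'
          rw [hup z hz1, hup z' hz2]
          exact hDD z hz1 z' hz2 hzz'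
    · rw [hbi, sum_insert ha, union_inter_distrib_right]
      refine (card_union_le _ _).trans (Nat.add_le_add (hEA.trans ?_) (hDA.trans ?_))
      · exact Nat.mul_le_mul_left _ (card_le_card
          (monotone_filter_right _ fun i _ hi => hmono hi))
      · exact sum_le_sum fun z _ => Nat.mul_le_mul_left _ (card_le_card
          (monotone_filter_right _ fun i _ hi => hmono hi))

end Hubs
section Absorber

variable {V : Type} [DecidableEq V] {G : SimpleGraph V} {q r C w b K m m₀ : ℕ} {e d p y : ℝ}

lemma hasKrFactorOn_of_matching {ι κ : Type} [DecidableEq ι] [Fintype κ] [DecidableEq κ]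
    {N : κ → Finset ι} {ξ : ι → V} (hξ : Function.Injective ξ) {U : Finset V}
    (hξU : ∀ i, ξ i ∈ U) {D : κ → Finset V} (hDU : ∀ z, Disjoint (D z) U)
    (hD : ∀ z, ∀ i ∈ N z, HasKrFactorOn G r (insert (ξ i) (D z)))
    (hDD : ∀ z z', z ≠ z' → Disjoint (D z) (D z')) {f : κ → ι} (hf : Function.Injective f)
    (hfN : ∀ z, f z ∈ N z) : HasKrFactorOn G r ((univ.image f).image ξ ∪ univ.biUnion D) := by
  have h : (univ.image f).image ξ ∪ univ.biUnion D =
      univ.biUnion fun z => insert (ξ (f z)) (D z) := by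
    ext v
    simp only [mem_union, mem_image, mem_univ, true_and, mem_biUnion, mem_insert,
      exists_exists_eq_and, eq_comm (a := v), exists_or]
  have hn : ∀ i z, ξ i ∉ D z := fun i z h => disjoint_left.1 (hDU z) h (hξU i)
  rw [h]
  refine HasKrFactorOn.biUnion _ _ (fun z _ => hD z _ (hfN z)) fun z _ z' _ hz => ?_
  rw [disjoint_insert_left, disjoint_insert_right, mem_insert, not_or]
  exact ⟨⟨fun h => hz (hf (hξ h)), hn _ _⟩, hn _ _, hDD z z' hz⟩

variable [Fintype V]

lemma ReachProp.exists_absorber {t : ℕ} (hR : ReachProp G r C w d) (hC : CliqueProp G q e)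
    (hq : q + 1 = r) (hm : 2 ≤ m) (ht : 240 ≤ t) (hmt : 6 * m ≤ 2 ^ t) {O X Y A : Finset V}
    (hX : #X = 2 * m) (hY : #Y = 2 * m) (hXY : Disjoint X Y) (hOA : Disjoint (O ∪ X ∪ Y) A)
    (hw : #O + 4 * m + #A + q * (3 + 140 * C) * m + K ≤ w)
    (hlow : ∀ W : Finset V, #W ≤ w → #(lowVertices G (d + K) W) ≤ b)
    (hK : (q + 2) * ((t + 20) * (C + 3)) ≤ K) (hd : e + b + q * (t + 20) ≤ d + K)
    (hA : ∀ v ∈ X ∪ Y, e + b + q * (t + 20) + q * (b * (t + 20)) ≤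
      (#(A.filter (G.Adj v)) : ℝ)) :
    ∃ H, Disjoint H (O ∪ X ∪ Y) ∧ ∀ Z ⊆ X, #Z = m → HasKrFactorOn G r (Z ∪ Y ∪ H) := by
  obtain ⟨N, hNsum, hN, hN', hNX⟩ := exists_template m t hm ht hmt
  let eX : Fin (2 * m) ≃ X := (X.equivFinOfCardEq hX).symm
  let eY : Fin (2 * m) ≃ Y := (Y.equivFinOfCardEq hY).symm
  let ξ : Fin (2 * m) ⊕ Fin (2 * m) → V := Sum.elim (fun i => eX i) fun i => eY i
  have hξ : Function.Injective ξ := by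
    refine Function.Injective.sumElim (Subtype.val_injective.comp eX.injective)
      (Subtype.val_injective.comp eY.injective) fun i j h => ?_
    exact disjoint_left.1 hXY (eX i).2 (h ▸ (eY j).2)
  have hξU : ∀ i, ξ i ∈ X ∪ Y := by
    rintro (i | i)
    · exact mem_union_left _ (eX i).2
    · exact mem_union_right _ (eY i).2
  have hξU' : ∀ i, ξ i ∈ O ∪ X ∪ Y := fun i => by
    rw [union_assoc]; exact mem_union_right _ (hξU i)
  obtain ⟨D, hD, hDD⟩ := hR.exists_hubs (U := O ∪ X ∪ Y) (A := A) (Δ := t + 20) hC hq N ξ hξ hξU'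
    (by
      have h1 : ∑ z, q * (1 + #(N z) * C) ≤ q * (3 + 140 * C) * m := by
        rw [← mul_sum, sum_add_distrib, ← sum_mul]
        simp only [sum_const, card_univ, Fintype.card_fin, smul_eq_mul, mul_one]
        calc q * (3 * m + (∑ z, #(N z)) * C) ≤ q * (3 * m + 140 * m * C) := by gcongr
          _ = _ := by ring
      have h2 := card_union_le (O ∪ X) Y
      have h3 := card_union_le O X
      omega) hlow hN hN' hK (by push_cast; exact hd) (fun i => by
      rw [sdiff_eq_self_of_disjoint hOA.symm]
      push_cast
      exact hA _ (hξU i))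
  refine ⟨univ.biUnion D, (disjoint_biUnion_left _ _ _).2 fun z _ => (hD z).1, fun Z hZ hZm => ?_⟩
  have hZc : #(univ.filter fun i => (eX i : V) ∈ Z) = m := by
    refine Eq.trans ?_ hZm
    refine card_bij (fun i _ => eX i) (fun i hi => (mem_filter.1 hi).2)
      (fun i _ j _ h => eX.injective (Subtype.ext h)) fun v hv => ?_
    obtain ⟨i, hi⟩ := eX.surjective ⟨v, hZ hv⟩
    have hi' : (eX i : V) = v := by rw [hi]
    exact ⟨i, by simp [hi', hv], hi'⟩
  obtain ⟨f, hf, hfN, hfi⟩ := hNX _ hZc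
  have := hasKrFactorOn_of_matching hξ hξU' (fun z => (hD z).1) (fun z => (hD z).2.2) hDD hf hfN
  rw [hfi] at this
  convert this using 2
  ext v
  simp only [mem_union, mem_image, mem_disjSum, mem_filter, mem_univ, true_and]
  constructor
  · rintro (hv | hv)
    · obtain ⟨i, hi⟩ := eX.surjective ⟨v, hZ hv⟩
      have hi' : (eX i : V) = v := by rw [hi]
      exact ⟨Sum.inl i, Or.inl ⟨i, by rwa [hi'], rfl⟩, hi'⟩
    · obtain ⟨i, hi⟩ := eY.surjective ⟨v, hv⟩
      exact ⟨Sum.inr i, Or.inr ⟨i, rfl⟩, by simp [ξ, hi]⟩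
  · rintro ⟨_, ⟨i, hi, rfl⟩ | ⟨i, rfl⟩, rfl⟩
    · exact Or.inl hi
    · exact Or.inr (eY i).2

/-- An absorbing structure for `X` yields a factor of the whole graph. -/
lemma hasKrFactorOn_univ_of_absorber (hS : SwitchProp G r m₀) (hD : DegProp G b y p)
    (hb : 0 < b) (hC : CliqueProp G q e) (hq : q + 1 = r) (hp : 0 ≤ p) (hr : r ∣ Fintype.card V)
    {O X X₁ Y H : Finset V} (hO : HasKrFactorOn G r O) (hX : #X = 2 * m) (hX₁ : X₁ ⊆ X)
    (hX₁m : m ≤ #X₁) (hOX : Disjoint O X) (hXY : Disjoint X Y) (hOY : Disjoint O Y)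
    (hH : Disjoint H (O ∪ X ∪ Y))
    (hZ : ∀ Z ⊆ X, #Z = m → HasKrFactorOn G r (Z ∪ Y ∪ H)) (hy : y ≤ m / 2)
    (he : e ≤ m * p / 4) (hm : 2 * (q * ((r + 1) * m₀)) + q * b ≤ m) (hm₀ : (r + 1) * m₀ ≤ m)
    (hdeg : ∀ v ∉ O, e + q * b ≤ (#((X \ X₁).filter (G.Adj v)) : ℝ)) :
    HasKrFactorOn G r (univ : Finset V) := by
  set U := (O ∪ X ∪ Y ∪ H)ᶜ with hU
  have hr0 : 0 < r := by omega
  obtain ⟨L, hLU, hLc, hF1⟩ := hS.exists_tiling hr0 U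
  have hUX : Disjoint U X := by
    rw [disjoint_left]; intro v hv; simp only [hU, mem_compl, mem_union] at hv; tauto
  have hUO : Disjoint U O := by
    rw [disjoint_left]; intro v hv; simp only [hU, mem_compl, mem_union] at hv; tauto
  have hLX := disjoint_of_subset_left hLU hUX
  obtain ⟨L', hL'L, hL'c, Q, hQ, hQc, hF2⟩ := hD.exists_almost_cover (L := L) (A := X₁) (a := m / 2)
    hb hC hq hp hy (by linarith) (disjoint_of_subset_right hX₁ hLX) (by
      have h1 : 2 * (q * #L) ≤ m := by
        have : q * #L ≤ q * ((r + 1) * m₀) := Nat.mul_le_mul_left _ hLc.le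
        omega
      have h2 : (2 * (q * #L) : ℝ) ≤ m := by exact_mod_cast h1
      have h3 : (m : ℝ) ≤ #X₁ := by exact_mod_cast hX₁m
      linarith)
  obtain ⟨Q', hQ', hQ'c, hF3⟩ := hC.exists_cover hq (L := L') (A := X \ X₁)
    (disjoint_of_subset_left hL'L (disjoint_of_subset_right sdiff_subset hLX)) (fun v hv => by
      refine le_trans ?_ (hdeg v (disjoint_left.1 hUO (hLU (hL'L hv))))
      have : (#L' : ℝ) ≤ b := by exact_mod_cast hL'c.le
      gcongr)
  have hQX := hQ.trans hX₁
  have hQ'X := hQ'.trans (sdiff_subset (t := X₁))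
  have hQQ' : Disjoint Q Q' :=
    disjoint_of_subset_left hQ (disjoint_of_subset_right hQ' disjoint_sdiff)
  have hused : #(Q ∪ Q') ≤ m := by
    have h1 : q * #L ≤ q * ((r + 1) * m₀) := Nat.mul_le_mul_left _ hLc.le
    have h2 : q * #L' ≤ q * b := Nat.mul_le_mul_left _ hL'c.le
    have := card_union_le Q Q'
    omega
  have hQQX : Q ∪ Q' ⊆ X := union_subset hQX hQ'X
  have hLL' : Disjoint (L \ L' ∪ Q) (L' ∪ Q') := by
    simp only [disjoint_union_left, disjoint_union_right]
    exact ⟨⟨sdiff_disjoint, (disjoint_of_subset_left hL'L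
      (disjoint_of_subset_right hQX hLX)).symm⟩, disjoint_of_subset_left sdiff_subset
      (disjoint_of_subset_right hQ'X hLX), hQQ'⟩
  have hF4 := hF2.union hF3 hLL'
  have h4 : L \ L' ∪ Q ∪ (L' ∪ Q') = L ∪ (Q ∪ Q') := by
    ext v
    have := @hL'L v
    simp only [mem_union, mem_sdiff]
    tauto
  rw [h4] at hF4
  have hF5 := hF1.union hF4 (by
    rw [disjoint_union_right]
    exact ⟨sdiff_disjoint, disjoint_of_subset_left sdiff_subset
      (disjoint_of_subset_right hQQX hUX)⟩)
  rw [← union_assoc, sdiff_union_of_subset hLU] at hF5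
  have hF6 := hO.union hF5 (by
    rw [disjoint_union_right]
    exact ⟨hUO.symm, disjoint_of_subset_right hQQX hOX⟩)
  have hHX : Disjoint X H := (disjoint_of_subset_right
    (subset_union_right.trans subset_union_left) hH).symm
  have hHY : Disjoint Y H := (disjoint_of_subset_right subset_union_right hH).symm
  have hHO : Disjoint O H := (disjoint_of_subset_right
    (subset_union_left.trans subset_union_left) hH).symm
  have hkey : ∀ Z ⊆ X, #Z = m → #(Z ∪ Y ∪ H) = m + #Y + #H := by
    intro Z hZX hZm
    rw [card_union_of_disjoint, card_union_of_disjoint (disjoint_of_subset_left hZX hXY), hZm]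
    rw [disjoint_union_left]
    exact ⟨disjoint_of_subset_left hZX hHX, hHY⟩
  have hdvd : r ∣ m - #(Q ∪ Q') := by
    obtain ⟨Z, hZX, hZm⟩ := exists_subset_card_eq (s := X) (n := m) (by omega)
    have h1 := (hZ Z hZX hZm).dvd_card
    rw [hkey Z hZX hZm] at h1
    have h2 := hF6.dvd_card
    have h3 : #(O ∪ (U ∪ (Q ∪ Q'))) = #O + #U + #(Q ∪ Q') := by
      rw [card_union_of_disjoint, card_union_of_disjoint (disjoint_of_subset_right hQQX hUX),
        add_assoc]
      rw [disjoint_union_right]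
      exact ⟨hUO.symm, disjoint_of_subset_right hQQX hOX⟩
    have h5 : #U + (#O + 2 * m + #Y + #H) = Fintype.card V := by
      have : #(O ∪ X ∪ Y ∪ H) = #O + 2 * m + #Y + #H := by
        rw [card_union_of_disjoint hH.symm, card_union_of_disjoint, card_union_of_disjoint hOX, hX]
        rw [disjoint_union_left]
        exact ⟨hOY, hXY⟩
      rw [← this, hU, card_compl]
      have := card_le_univ (O ∪ X ∪ Y ∪ H)
      omega
    rw [h3] at h2
    have h6 : Fintype.card V = (#O + #U + #(Q ∪ Q')) + (m + #Y + #H) + (m - #(Q ∪ Q')) := by omega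
    rw [h6] at hr
    exact (Nat.dvd_add_right (dvd_add h2 h1)).1 hr
  obtain ⟨k, hk⟩ := hdvd
  obtain ⟨R, hR, hRc, hF7⟩ := hS.exists_disjoint_cliques k (U := X \ (Q ∪ Q')) (by
    rw [card_sdiff_of_subset hQQX, hX, mul_comm k, ← hk]
    omega)
  have hRX := hR.trans (sdiff_subset (t := Q ∪ Q'))
  have hRQ : Disjoint R (Q ∪ Q') := disjoint_of_subset_left hR sdiff_disjoint
  have hF8 := hZ (X \ (Q ∪ Q' ∪ R)) sdiff_subset (by
    rw [card_sdiff_of_subset (union_subset hQQX hRX), card_union_of_disjoint hRQ.symm, hX, hRc,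
      mul_comm k, ← hk]
    omega)
  have hUY : Disjoint U Y := by
    rw [disjoint_left]; intro v hv; simp only [hU, mem_compl, mem_union] at hv; tauto
  have hUH : Disjoint U H := by
    rw [disjoint_left]; intro v hv; simp only [hU, mem_compl, mem_union] at hv; tauto
  have hF9 := hF6.union hF7 (by
    simp only [disjoint_union_left]
    exact ⟨disjoint_of_subset_right hRX hOX, disjoint_of_subset_right hRX hUX,
      disjoint_union_left.1 hRQ.symm⟩)
  have hF10 := hF9.union hF8 (by
    have hsub : Q ∪ Q' ∪ R ⊆ X := union_subset hQQX hRX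
    have h1 : O ∪ (U ∪ (Q ∪ Q')) ∪ R = O ∪ U ∪ (Q ∪ Q' ∪ R) := by
      ext v; simp only [mem_union]; tauto
    rw [h1]
    simp only [disjoint_union_left (s := O ∪ U), disjoint_union_left (s := O),
      disjoint_union_right]
    exact ⟨⟨⟨⟨disjoint_of_subset_right sdiff_subset hOX, hOY⟩, hHO⟩,
      ⟨disjoint_of_subset_right sdiff_subset hUX, hUY⟩, hUH⟩,
      ⟨disjoint_sdiff, disjoint_of_subset_left hsub hXY⟩, disjoint_of_subset_left hsub hHX⟩)
  convert hF10
  ext v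
  simp only [hU, mem_union, mem_univ, mem_compl, mem_sdiff, true_iff]
  tauto

end Absorber
section Assembly

variable {V : Type} [Fintype V] [DecidableEq V] {G : SimpleGraph V} {q r C w b K m m₀ t : ℕ}
  {e d p y δ : ℝ}

lemma DegProp.card_lowVertices_le (hD : DegProp G b y p) (hp : 0 ≤ p)
    (hw : 2 * w ≤ Fintype.card V) (hb : 4 * b ≤ Fintype.card V) (hy : 4 * y ≤ Fintype.card V)
    (hd : d ≤ Fintype.card V * p / 8) {W : Finset V} (hW : #W ≤ w) :
    #(lowVertices G d W) ≤ b := by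
  have h1 : Fintype.card V ≤ 2 * #Wᶜ := by rw [card_compl]; omega
  have h2 : (Fintype.card V : ℝ) ≤ 2 * #Wᶜ := by exact_mod_cast h1
  refine le_trans (card_le_card fun v hv => ?_)
    (hD.card_low_lt hp (Y := Wᶜ) (by omega) (by linarith)).le
  simp only [lowVertices, mem_filter, mem_univ, true_and] at hv ⊢
  refine hv.trans_le (hd.trans ?_)
  have := mul_le_mul_of_nonneg_right h2 hp
  linarith

lemma hasKrFactorOn_univ_of_props (hS : SwitchProp G r m₀) (hD : DegProp G b y p)
    (hb : 0 < b) (hC : CliqueProp G q e) (hR : ReachProp G r C w d) (hq : q + 1 = r) (hp : 0 ≤ p)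
    (hr : r ∣ Fintype.card V) (hdeg : ∀ v, δ ≤ (#(univ.filter (G.Adj v)) : ℝ))
    (hδ : e + q * (2 * b) + 2 * b ≤ δ) (hw : 2 * w ≤ Fintype.card V)
    (hm : 2 ≤ m) (ht : 240 ≤ t) (hmt : 6 * m ≤ 2 ^ t) (hbm : 2 * b ≤ m) (hym : 2 * y ≤ m)
    (hd : d + K ≤ Fintype.card V * p / 8)
    (hmw : 2 * b * r + 5 * m + q * (3 + 140 * C) * m + K ≤ w)
    (hK : (q + 2) * ((t + 20) * (C + 3)) ≤ K) (hdK : e + b + q * (t + 20) ≤ d + K)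
    (hm₀ : 2 * (q * ((r + 1) * m₀)) + q * b ≤ m) (hm₀' : (r + 1) * m₀ ≤ m)
    (hmp : e + b + q * (t + 20) + q * (b * (t + 20)) + 2 * b * r ≤ m * p / 4) :
    HasKrFactorOn G r (univ : Finset V) := by
  obtain ⟨P, hP, -, hPm⟩ := exists_disjoint_family 2 m (univ : Finset V)
    (by rw [card_univ]; omega)
  have hlow : ∀ i, #(univ.filter fun v => (#((P i).filter (G.Adj v)) : ℝ) < m * p / 4) < b := by
    intro i
    have := hD.card_low_lt hp (Y := P i) (by rw [hPm]; exact hbm) (by rw [hPm]; exact hym)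
    rwa [hPm] at this
  set B := univ.filter fun v => ∃ i, (#((P i).filter (G.Adj v)) : ℝ) < m * p / 4 with hB
  have hBc : #B ≤ 2 * b := by
    refine le_trans (card_le_card (t := univ.biUnion fun i =>
      univ.filter fun v => (#((P i).filter (G.Adj v)) : ℝ) < m * p / 4) fun v hv => ?_)
      ((card_biUnion_le_card_mul univ _ b fun i _ => (hlow i).le).trans (by simp))
    simpa [hB] using hv
  have hBc' : (#B : ℝ) ≤ 2 * b := by exact_mod_cast hBc
  obtain ⟨Q, hQ, hQc, hO⟩ := hC.exists_cover hq (L := B) (A := Bᶜ) disjoint_compl_right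
    fun v _ => by
      have h1 : #(univ.filter (G.Adj v)) ≤ #(Bᶜ.filter (G.Adj v)) + #B := by
        refine le_trans (card_le_card fun u hu => ?_) (card_union_le _ _)
        simp only [mem_union, mem_filter, mem_compl, mem_univ, true_and] at hu ⊢
        tauto
      have h2 : (#(univ.filter (G.Adj v)) : ℝ) ≤ #(Bᶜ.filter (G.Adj v)) + #B := by
        exact_mod_cast h1
      have h3 : (q : ℝ) * #B ≤ q * (2 * b) := by gcongr
      linarith [hdeg v]
  set O := B ∪ Q with hOdef
  have hOc : #O ≤ 2 * b * r := by
    have h1 : #O ≤ #B + #Q := card_union_le B Q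
    have h2 : q * #B ≤ q * (2 * b) := Nat.mul_le_mul_left _ hBc
    rw [← hq, mul_add, mul_one, mul_comm (2 * b) q]
    omega
  have hOc' : (#O : ℝ) ≤ 2 * b * r := by exact_mod_cast hOc
  have hPdeg : ∀ v ∉ O, ∀ i, m * p / 4 - 2 * b * r ≤ (#((P i \ O).filter (G.Adj v)) : ℝ) := by
    intro v hv i
    have h0 : ¬ (#((P i).filter (G.Adj v)) : ℝ) < m * p / 4 := fun h =>
      hv (mem_union_left _ (mem_filter.2 ⟨mem_univ _, i, h⟩))
    have h1 : #((P i).filter (G.Adj v)) ≤ #((P i \ O).filter (G.Adj v)) + #O := by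
      refine le_trans (card_le_card fun u hu => ?_) (card_union_le _ _)
      simp only [mem_union, mem_filter, mem_sdiff] at hu ⊢
      tauto
    have h2 : (#((P i).filter (G.Adj v)) : ℝ) ≤ #((P i \ O).filter (G.Adj v)) + #O := by
      exact_mod_cast h1
    push Not at h0
    linarith
  set A := P 1 \ O with hA
  have hAc : #A ≤ m := (card_le_card sdiff_subset).trans (hPm 1).le
  have hX₂c : #(P 0 \ O) ≤ m := (card_le_card sdiff_subset).trans (hPm 0).le
  have hOAc := card_union_le O A
  obtain ⟨X, hX₂X, hXOA, hX⟩ := exists_subsuperset_card_eq (s := P 0 \ O) (t := (O ∪ A)ᶜ)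
    (n := 2 * m) (fun v hv => by
      obtain ⟨h1, h2⟩ := mem_sdiff.1 hv
      have h3 : v ∉ P 1 := disjoint_left.1 (hP 0 1 (by decide)) h1
      simp [hA, h2, h3]) (by omega) (by rw [card_compl]; omega)
  obtain ⟨Y, hYOAX, hY⟩ := exists_subset_card_eq (s := (O ∪ A ∪ X)ᶜ) (n := 2 * m) (by
    have := card_union_le (O ∪ A) X
    rw [card_compl]
    omega)
  have hOX : Disjoint O X := by
    rw [disjoint_left]; intro v hv hvX; have := hXOA hvX; simp [hv] at this
  have hAX : Disjoint A X := by
    rw [disjoint_left]; intro v hv hvX; have := hXOA hvX; simp [hv] at this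
  have hOY : Disjoint O Y := by
    rw [disjoint_left]; intro v hv hvX; have := hYOAX hvX; simp [hv] at this
  have hAY : Disjoint A Y := by
    rw [disjoint_left]; intro v hv hvX; have := hYOAX hvX; simp [hv] at this
  have hXY : Disjoint X Y := by
    rw [disjoint_left]; intro v hv hvX; have := hYOAX hvX; simp [hv] at this
  have hOA : Disjoint O A := disjoint_sdiff
  have hb0 : (0 : ℝ) ≤ b := b.cast_nonneg
  have hq0 : (0 : ℝ) ≤ q := q.cast_nonneg
  have ht0 : (0 : ℝ) ≤ t := t.cast_nonneg
  have hqb : (q : ℝ) * b ≤ q * (b * (t + 20)) := by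
    refine mul_le_mul_of_nonneg_left ?_ hq0
    nlinarith
  have hqt : 0 ≤ (q : ℝ) * (t + 20) := by positivity
  have hqb0 : 0 ≤ (q : ℝ) * (b * (t + 20)) := by positivity
  have hbr : 0 ≤ (2 : ℝ) * b * r := by positivity
  obtain ⟨H, hH, hZ⟩ := hR.exists_absorber (K := K) (b := b) hC hq hm ht hmt (O := O) hX hY hXY
    (by simp only [disjoint_union_left]; exact ⟨⟨hOA, hAX.symm⟩, hAY.symm⟩) (by omega)
    (fun W hW => hD.card_lowVertices_le hp hw (by omega) (by
      have h1 : 2 * m ≤ Fintype.card V := by omega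
      have h2 : (2 * m : ℝ) ≤ Fintype.card V := by exact_mod_cast h1
      linarith) hd hW) hK hdK (fun v hv => by
      have hvO : v ∉ O := by
        rcases mem_union.1 hv with h | h
        · exact disjoint_right.1 hOX h
        · exact disjoint_right.1 hOY h
      have := hPdeg v hvO 1
      linarith)
  refine hasKrFactorOn_univ_of_absorber hS hD hb hC hq hp hr hO hX (X₁ := X \ (P 0 \ O))
    sdiff_subset (by rw [card_sdiff_of_subset hX₂X]; omega) hOX hXY hOY hH hZ (by linarith)
    (by linarith) hm₀ hm₀' fun v hv => ?_
  rw [Finset.sdiff_sdiff_eq_self hX₂X]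
  have := hPdeg v hv 0
  linarith

end Assembly

section Asymptotics

lemma exists_reachProp_constants (q J : ℕ) : ∃ C κ : ℕ, 0 < κ ∧
    ∀ {V : Type} [Fintype V] [DecidableEq V] (G : SimpleGraph V) (m N t s g b w : ℕ)
      (y p e d : ℝ), SwitchProp G (q + 1) m → DegProp G b y p → CliqueProp G q e → 0 ≤ p →
      1 ≤ t → N ≤ t ^ J → κ * m < N → (q + 2) * s + w ≤ Fintype.card V →
      N + (q + 2) * (t * N) + g ≤ s → κ ≤ g → 2 * b * κ ≤ g → 2 * y * κ ≤ g →
      4 * ((e + κ) * κ) ≤ g * p → e + κ + b ≤ d → ReachProp G (q + 1) C w d := by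
  obtain ⟨r, hr⟩ : ∃ r, r = q + 1 := ⟨_, rfl⟩
  obtain ⟨c, hc⟩ : ∃ c, c = 1 + J * r := ⟨_, rfl⟩
  obtain ⟨c₂, hc₂⟩ : ∃ c₂, c₂ = 2 * c + r + 1 := ⟨_, rfl⟩
  obtain ⟨c₁, hc₁⟩ : ∃ c₁, c₁ = 2 + q * (1 + 2 * (2 * c₂)) := ⟨_, rfl⟩
  obtain ⟨K₁, hK₁⟩ : ∃ K₁, K₁ = (q + 2) * (2 * (c₁ + 3)) := ⟨_, rfl⟩
  obtain ⟨K, hK⟩ : ∃ K, K = K₁ + (q + 2) * (2 * (2 * c₂ + 3)) := ⟨_, rfl⟩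
  obtain ⟨K₂, hK₂⟩ : ∃ K₂, K₂ = K + c₂ + 1 := ⟨_, rfl⟩
  obtain ⟨K₃, hK₃⟩ : ∃ K₃, K₃ = 2 * (r + 1) * K₂ := ⟨_, rfl⟩
  obtain ⟨T, hT⟩ : ∃ T, T = (r + 1) * K + 1 := ⟨_, rfl⟩
  obtain ⟨κ₁, hκ₁⟩ : ∃ κ₁, κ₁ = (2 * (r + 1)) ^ T := ⟨_, rfl⟩
  obtain ⟨κ₂, hκ₂⟩ : ∃ κ₂, κ₂ = 2 * ((r + 1) * (1 + (c + K₃) + 2 * (c + K₃) * (r + 1))) := ⟨_, rfl⟩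
  obtain ⟨κ, hκ⟩ : ∃ κ, κ = κ₁ + κ₂ + (K₁ + q + 2) := ⟨_, rfl⟩
  have hκ0 : 0 < κ := by omega
  refine ⟨2 + q * (1 + 2 * c₁), κ, hκ0, ?_⟩
  intro V _ _ G m N t s g b w y p e d hS hD hC hp ht hN hmN hs hg hκg hbg hyg heg hd
  rw [← hr] at hS ⊢
  have hq2 : q + 2 = r + 1 := by omega
  rw [hq2] at hs hg
  intro W x x' hW hx hx' hxd hxd'
  have : Nonempty V := ⟨x⟩
  obtain ⟨Y, hYW, hYc, hY⟩ := hS.exists_robust_set W ht hN hc hc₂ hK₂ hK₃ hT (g := g) (s := s)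
    (by
      refine lt_of_le_of_lt ?_ hmN
      calc 2 * ((r + 1) * m * (1 + (c + K₃) + 2 * (c + K₃) * (r + 1))) = κ₂ * m := by
            rw [hκ₂]; ring
        _ ≤ κ * m := Nat.mul_le_mul_right _ (by omega)) (by rw [card_compl]; omega) hg
    (by rw [← hκ₁]; omega)
  rw [← hκ₁] at hYc
  have hgY : g ≤ κ * #Y := hYc.trans (Nat.mul_le_mul_right _ (by omega))
  have hgY' : (g : ℝ) ≤ κ * #Y := by exact_mod_cast hgY
  have hκ0' : (0 : ℝ) < κ := by exact_mod_cast hκ0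
  have hκ' : (K₁ : ℝ) + q + 2 ≤ κ := by exact_mod_cast (by omega : K₁ + q + 2 ≤ κ)
  have hK₁0 : (0 : ℝ) ≤ K₁ := K₁.cast_nonneg
  rw [hc₁]
  refine reach_of_robust_set (K₁ := K₁) (K := K) hD hC hp hYW hY hr.symm ?_ ?_ ?_ hK.ge
    (by rw [hK₁, hc₁]) hx hx' ?_ ?_
  · refine Nat.le_of_mul_le_mul_left (c := κ) ?_ hκ0
    rw [mul_comm]
    exact hbg.trans hgY
  · refine le_of_mul_le_mul_left ?_ hκ0'
    rw [mul_comm]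
    exact hyg.trans hgY'
  · have h1 : 4 * ((e + κ) * κ) ≤ κ * #Y * p := heg.trans (mul_le_mul_of_nonneg_right hgY' hp)
    have h2 : κ * (4 * (e + κ)) ≤ κ * (#Y * p) := by linarith
    have h3 := le_of_mul_le_mul_left h2 hκ0'
    linarith
  · linarith
  · linarith

open Filter in
lemma eventually_ceil_mul_log_le {η : ℝ} (hη : 0 < η) : ∀ᶠ n : ℕ in atTop, ∀ p : ℝ,
    (n : ℝ) ^ (-(1 : ℝ) / 3) ≤ p →
      0 < Real.log n / p ∧
      ((⌈Real.log n / p⌉₊ * (Nat.log 2 (6 * n) + 261) : ℕ) : ℝ) ≤ η * (n * p) := by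
  have h1 : ∀ᶠ x : ℝ in atTop, Real.log x ^ (2 : ℝ) ≤ η / 600 * x ^ (1 / 3 : ℝ) := by
    filter_upwards [(isLittleO_log_rpow_rpow_atTop 2 (by norm_num : (0 : ℝ) < 1 / 3)).bound
      (by positivity : 0 < η / 600), eventually_ge_atTop 1] with x hx hx1
    have h2 : 0 ≤ x ^ (1 / 3 : ℝ) := by positivity
    rw [Real.norm_eq_abs, Real.norm_eq_abs, abs_of_nonneg h2] at hx
    exact (le_abs_self _).trans hx
  have h2 : ∀ᶠ x : ℝ in atTop, 1 ≤ Real.log x :=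
    Real.tendsto_log_atTop.eventually_ge_atTop 1
  filter_upwards [tendsto_natCast_atTop_atTop.eventually h1,
    tendsto_natCast_atTop_atTop.eventually h2, eventually_ge_atTop 1] with n hn hL hn1 p hp
  set x : ℝ := (n : ℝ) with hx
  set L := Real.log x with hLdef
  have hx0 : 0 < x := by rw [hx]; exact_mod_cast hn1
  have hx1 : 1 ≤ x := by rw [hx]; exact_mod_cast hn1
  set z := x ^ (1 / 3 : ℝ) with hz
  have hz0 : 0 < z := by positivity
  have hz1 : 1 ≤ z := Real.one_le_rpow hx1 (by norm_num)
  have hzinv : x ^ (-(1 : ℝ) / 3) = z⁻¹ := by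
    rw [hz, ← Real.rpow_neg hx0.le]; norm_num
  rw [hzinv] at hp
  have hp0 : 0 < p := lt_of_lt_of_le (by positivity) hp
  have hzzz : z * z * z = x := by
    rw [hz, ← Real.rpow_add hx0, ← Real.rpow_add hx0]; norm_num
  have hzz : z * z ≤ x * p := by
    calc z * z = x * z⁻¹ := by rw [← hzzz]; field_simp
      _ ≤ x * p := by gcongr
  refine ⟨div_pos (by linarith) hp0, ?_⟩
  have hb : (⌈L / p⌉₊ : ℝ) ≤ 2 * (z * L) := by
    have h3 : L / p ≤ z * L := by
      rw [div_le_iff₀ hp0]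
      have : 1 ≤ z * p := by
        calc 1 = z * z⁻¹ := by field_simp
          _ ≤ z * p := by gcongr
      nlinarith
    have h4 := Nat.ceil_lt_add_one (div_nonneg (by linarith : 0 ≤ L) hp0.le)
    have h5 : 1 ≤ z * L := one_le_mul_of_one_le_of_one_le hz1 hL
    linarith
  have ht : ((Nat.log 2 (6 * n) + 261 : ℕ) : ℝ) ≤ 300 * L := by
    have h3 := Real.natLog_le_logb (6 * n) 2
    have h4 : Real.logb 2 ((6 * n : ℕ) : ℝ) = (Real.log 6 + L) / Real.log 2 := by
      rw [Real.logb, hLdef, hx]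
      push_cast
      rw [Real.log_mul (by norm_num) (by positivity)]
    have h5 : Real.log 6 ≤ 5 := by
      have := Real.log_le_sub_one_of_pos (by norm_num : (0 : ℝ) < 6)
      linarith
    have h6 : (Real.log 6 + L) / Real.log 2 ≤ 12 * L := by
      have := Real.log_two_gt_d9
      rw [div_le_iff₀ (by linarith)]
      nlinarith
    push_cast at h3 h4 ⊢
    rw [h4] at h3
    linarith
  have hn' : L * L ≤ η / 600 * z := by
    have : L ^ (2 : ℝ) = L * L := by rw [Real.rpow_two, sq]
    rwa [this] at hn
  have hL0 : 0 ≤ L := by linarith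
  calc ((⌈L / p⌉₊ * (Nat.log 2 (6 * n) + 261) : ℕ) : ℝ)
      = (⌈L / p⌉₊ : ℝ) * ((Nat.log 2 (6 * n) + 261 : ℕ) : ℝ) := by push_cast; ring
    _ ≤ 2 * (z * L) * (300 * L) := by gcongr
    _ = 600 * z * (L * L) := by ring
    _ ≤ 600 * z * (η / 600 * z) := by gcongr
    _ = η * (z * z) := by ring
    _ ≤ η * (x * p) := by gcongr

open Filter in
lemma eventually_ceil_rpow_mul_le {η β : ℝ} (hη : 0 < η) (hβ : 0 < β) (hβ1 : β ≤ 1) :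
    ∀ᶠ n : ℕ in atTop,
      (((⌈(n : ℝ) ^ (1 - β)⌉₊ + 1) * (⌈(n : ℝ) ^ (β / 2)⌉₊ + 1) : ℕ) : ℝ) ≤ η * n := by
  have h1 : ∀ᶠ x : ℝ in atTop, x ^ (-(β / 2)) ≤ η / 9 :=
    (tendsto_rpow_neg_atTop (by positivity : 0 < β / 2)).eventually_le_const (by positivity)
  filter_upwards [tendsto_natCast_atTop_atTop.eventually h1, eventually_ge_atTop 1] with n hn hn1
  set x : ℝ := (n : ℝ) with hx
  have hx0 : 0 < x := by rw [hx]; exact_mod_cast hn1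
  have hx1 : 1 ≤ x := by rw [hx]; exact_mod_cast hn1
  have h2 : ∀ a : ℝ, 0 ≤ a → ((⌈x ^ a⌉₊ : ℝ) + 1) ≤ 3 * x ^ a := by
    intro a ha
    have h3 := Nat.ceil_lt_add_one (by positivity : 0 ≤ x ^ a)
    have h4 := Real.one_le_rpow hx1 ha
    linarith
  push_cast
  calc ((⌈x ^ (1 - β)⌉₊ : ℝ) + 1) * ((⌈x ^ (β / 2)⌉₊ : ℝ) + 1)
      ≤ (3 * x ^ (1 - β)) * (3 * x ^ (β / 2)) := by
        gcongr
        · exact h2 _ (by linarith)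
        · exact h2 _ (by linarith)
    _ = 9 * x ^ (-(β / 2)) * x := by
        have : x ^ (-(β / 2)) * x = x ^ (1 - β) * x ^ (β / 2) := by
          rw [← Real.rpow_add hx0, ← Real.rpow_add_one hx0.ne']
          congr 1; ring
        linear_combination (-9) * this
    _ ≤ 9 * (η / 9) * x := by gcongr
    _ = η * x := by ring

end Asymptotics

section Final

variable {V : Type} [Fintype V] [DecidableEq V]

/-- The density below which the error terms of the embedding argument are negligible, as the
reciprocal of a natural number. -/
def scaleConst (q C κ : ℕ) : ℕ :=
  2 * (2 * q + 3) + 16 * ((q + 2) * (C + 3)) + 32 * (q + 1)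
    + 2 * (8 * (6 + q * (3 + 140 * C))) * (2 * (q * (q + 2)) + 2 * q + 8)
    + 2 * (8 * (6 + q * (3 + 140 * C))) * (4 * (4 + 4 * q))
    + 16 * ((q + 2) * (q + 2) * (κ + 1))
    + 32 * (q + 2) * (4 * ((1 + κ) * κ) + 2 * κ + 1) + 16 * (2 + κ) + (κ + 1)

set_option maxHeartbeats 1000000 in
lemma hasKrFactorOn_univ_of_scale {G : SimpleGraph V} {q C κ J b τ m₀ t : ℕ} {p η : ℝ}
    (hR : ∀ (m N t s g b w : ℕ) (y p e d : ℝ), SwitchProp G (q + 1) m → DegProp G b y p →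
      CliqueProp G q e → 0 ≤ p → 1 ≤ t → N ≤ t ^ J → κ * m < N →
      (q + 2) * s + w ≤ Fintype.card V → N + (q + 2) * (t * N) + g ≤ s → κ ≤ g →
      2 * b * κ ≤ g → 2 * y * κ ≤ g → 4 * ((e + κ) * κ) ≤ g * p → e + κ + b ≤ d →
      ReachProp G (q + 1) C w d)
    (hS : SwitchProp G (q + 1) m₀) (hD : DegProp G b (η * Fintype.card V) p)
    (hC : CliqueProp G q (η * Fintype.card V * p))
    (hdeg : ∀ v, (Fintype.card V * p / 2 : ℝ) ≤ #(univ.filter (G.Adj v)))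
    (hb : 0 < b) (hp0 : 0 ≤ p) (hp1 : p ≤ 1) (hr : q + 1 ∣ Fintype.card V) (hτ : 240 ≤ τ)
    (hlog : 6 * Fintype.card V ≤ 2 ^ τ) (ht : 1 ≤ t)
    (hB : ((b * (τ + 21) : ℕ) : ℝ) ≤ η * (Fintype.card V * p))
    (hm₀ : (((m₀ + 1) * (t + 1) : ℕ) : ℝ) ≤ η * Fintype.card V)
    (htJ : Fintype.card V ≤ t ^ J) (hη : 0 < η) (hηΘ : η * scaleConst q C κ = 1) :
    HasKrFactorOn G (q + 1) (univ : Finset V) := by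
  obtain ⟨n, hn⟩ : ∃ n, n = Fintype.card V := ⟨_, rfl⟩
  obtain ⟨M, hM⟩ : ∃ M, M = 8 * (6 + q * (3 + 140 * C)) := ⟨_, rfl⟩
  obtain ⟨Θ, hΘ⟩ : ∃ Θ, Θ = scaleConst q C κ := ⟨_, rfl⟩
  rw [← hn] at hr hlog htJ hm₀ hB hD hC hdeg hR
  rw [← hΘ] at hηΘ
  simp only [scaleConst, ← hM] at hΘ
  have hΘ₁ : 2 * (2 * q + 3) ≤ Θ := by omega
  have hΘ₂ : 16 * ((q + 2) * (C + 3)) ≤ Θ := by omega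
  have hΘ₃ : 32 * (q + 1) ≤ Θ := by omega
  have hΘ₄ : 2 * M * (2 * (q * (q + 2)) + 2 * q + 8) ≤ Θ := by omega
  have hΘ₅ : 2 * M * (4 * (4 + 4 * q)) ≤ Θ := by omega
  have hΘ₆ : 16 * ((q + 2) * (q + 2) * (κ + 1)) ≤ Θ := by omega
  have hΘ₇ : 32 * (q + 2) * (4 * ((1 + κ) * κ) + 2 * κ + 1) ≤ Θ := by omega
  have hΘ₈ : 16 * (2 + κ) ≤ Θ := by omega
  have hΘ₉ : κ + 1 ≤ Θ := by omega
  clear hΘ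
  obtain ⟨v, hv⟩ : ∃ v : ℝ, v = η * n := ⟨_, rfl⟩
  obtain ⟨u, hu⟩ : ∃ u : ℝ, u = v * p := ⟨_, rfl⟩
  rw [← hv] at hD hm₀ hC
  rw [← hu] at hC
  rw [← mul_assoc, ← hv, ← hu] at hB
  have hv0 : 0 ≤ v := by rw [hv]; positivity
  have hu0 : 0 ≤ u := by rw [hu]; positivity
  have huv : u ≤ v := by rw [hu]; exact mul_le_of_le_one_right hv0 hp1
  have hΘv : Θ * v = n := by rw [hv, ← mul_assoc, mul_comm (Θ : ℝ), hηΘ, one_mul]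
  have hcv : ∀ c : ℕ, c ≤ Θ → c * v ≤ n := fun c hc => by
    rw [← hΘv]
    have : (c : ℝ) ≤ Θ := by exact_mod_cast hc
    gcongr
  have hcu : ∀ c : ℕ, c ≤ Θ → c * u ≤ n * p := fun c hc => by
    rw [hu, ← mul_assoc]
    exact mul_le_mul_of_nonneg_right (hcv c hc) hp0
  have hle : ∀ k : ℕ, k ≤ b * (τ + 21) → (k : ℝ) ≤ u := fun k hk =>
    le_trans (by exact_mod_cast hk) hB
  have hbu : (b : ℝ) ≤ u := hle b (by nlinarith)
  have hτu : ((τ + 20 : ℕ) : ℝ) ≤ u := hle _ (by nlinarith)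
  have hbτu : ((b * (τ + 20) : ℕ) : ℝ) ≤ u := hle _ (by nlinarith)
  have h1u : (1 : ℝ) ≤ u := by
    have := hle 1 (by nlinarith)
    exact_mod_cast this
  have h1v : (1 : ℝ) ≤ v := h1u.trans huv
  obtain ⟨m, hmdef⟩ : ∃ m, m = n / M := ⟨_, rfl⟩
  have hM0 : 0 < M := by omega
  have hMm : M * m ≤ n := by rw [hmdef]; exact Nat.mul_div_le n M
  have hkm : ∀ k : ℕ, 2 * M * k ≤ Θ → k * v ≤ m := fun k hk => by
    have h1 := hcv _ hk
    have h2 := hcv (2 * M) (le_trans (Nat.le_mul_of_pos_right _ (by omega)) hΘ₄)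
    have h3 : (n : ℝ) ≤ M * m + M := by
      have := Nat.lt_mul_div_succ n hM0
      rw [← hmdef] at this
      have h : n ≤ M * m + M := by linarith
      exact_mod_cast h
    have hM0' : (0 : ℝ) < M := by exact_mod_cast hM0
    push_cast at h1 h2
    have h4 : (M : ℝ) ≤ M * v := le_mul_of_one_le_right hM0'.le h1v
    refine le_of_mul_le_mul_left ?_ hM0'
    linarith
  obtain ⟨g, hgdef⟩ : ∃ g, g = n / (16 * (q + 2)) := ⟨_, rfl⟩
  have hkg : ∀ k : ℕ, 32 * (q + 2) * k ≤ Θ → k * v ≤ g := fun k hk => by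
    have h1 := hcv _ hk
    have h2 := hcv (32 * (q + 2)) (le_trans (Nat.le_mul_of_pos_right _ (by omega)) hΘ₇)
    have h3 : (n : ℝ) ≤ 16 * (q + 2) * g + 16 * (q + 2) := by
      have := Nat.lt_mul_div_succ n (show 0 < 16 * (q + 2) by omega)
      rw [← hgdef] at this
      have h : n ≤ 16 * (q + 2) * g + 16 * (q + 2) := by linarith
      exact_mod_cast h
    have hq0 : (0 : ℝ) < 16 * (q + 2) := by positivity
    push_cast at h1 h2
    have h4 : (16 * (q + 2) : ℝ) ≤ 16 * (q + 2) * v := le_mul_of_one_le_right hq0.le h1v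
    refine le_of_mul_le_mul_left ?_ hq0
    linarith
  have hkg' : ∀ k : ℕ, k ≤ 4 * ((1 + κ) * κ) + 2 * κ + 1 → k * v ≤ g := fun k hk =>
    hkg k ((Nat.mul_le_mul_left _ hk).trans hΘ₇)
  have hkm' : ∀ k : ℕ, k ≤ 2 * (q * (q + 2)) + 2 * q + 8 → k * v ≤ m := fun k hk =>
    hkm k ((Nat.mul_le_mul_left _ hk).trans hΘ₄)
  have hm₀v : (m₀ : ℝ) ≤ v := le_trans (by
    have : m₀ ≤ (m₀ + 1) * (t + 1) := by nlinarith
    exact_mod_cast this) hm₀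
  have heκ : u + κ + b ≤ n * p / 16 := by
    have h := hcu _ hΘ₈
    push_cast at h
    nlinarith [(Nat.cast_nonneg κ : (0 : ℝ) ≤ κ)]
  obtain ⟨K, hK⟩ : ∃ K, K = (q + 2) * ((τ + 20) * (C + 3)) := ⟨_, rfl⟩
  have hKu : (K : ℝ) ≤ n * p / 16 := by
    have h := hcu _ hΘ₂
    have h2 : (K : ℝ) = (q + 2) * (C + 3) * ((τ + 20 : ℕ) : ℝ) := by rw [hK]; push_cast; ring
    have h3 : (q + 2) * (C + 3) * ((τ + 20 : ℕ) : ℝ) ≤ (q + 2) * (C + 3) * u := by gcongr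
    push_cast at h
    linarith
  have hnp : (n : ℝ) * p ≤ n := mul_le_of_le_one_right (by positivity) hp1
  have hbv : (b : ℝ) ≤ v := hbu.trans huv
  have hReach : ReachProp G (q + 1) C (n / 2) (n * p / 16) := by
    refine hR m₀ (κ * m₀ + 1) t (n / (4 * (q + 2))) g b (n / 2) v p u _ hS hD hC hp0 ht ?_
      (Nat.lt_succ_self _) ?_ ?_ ?_ ?_ ?_ ?_ heκ
    · have h := hcv _ hΘ₉
      have h2 : (κ : ℝ) * m₀ ≤ κ * v := by gcongr
      have h3 : ((κ * m₀ + 1 : ℕ) : ℝ) ≤ n := by push_cast at h ⊢; linarith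
      exact le_trans (by exact_mod_cast h3) htJ
    · have := Nat.mul_div_le n (4 * (q + 2))
      have : 4 * ((q + 2) * (n / (4 * (q + 2)))) ≤ n := by rw [← mul_assoc]; exact this
      omega
    · refine le_of_mul_le_mul_left (a := 16 * (q + 2)) ?_ (by omega)
      have h := hcv _ hΘ₆
      have h1 : κ * m₀ + 1 + (q + 2) * (t * (κ * m₀ + 1)) ≤
          (q + 2) * (κ + 1) * ((m₀ + 1) * (t + 1)) := by
        have h2 : κ * m₀ + 1 ≤ (κ + 1) * (m₀ + 1) := by nlinarith
        calc κ * m₀ + 1 + (q + 2) * (t * (κ * m₀ + 1))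
            ≤ (q + 2) * (κ * m₀ + 1) + (q + 2) * (t * (κ * m₀ + 1)) := by
              gcongr
              exact Nat.le_mul_of_pos_left _ (by omega)
          _ = (q + 2) * ((κ * m₀ + 1) * (t + 1)) := by ring
          _ ≤ (q + 2) * ((κ + 1) * (m₀ + 1) * (t + 1)) := by gcongr
          _ = _ := by ring
      have h2 : 16 * (q + 2) * (κ * m₀ + 1 + (q + 2) * (t * (κ * m₀ + 1))) ≤ n := by
        have h3 : ((16 * (q + 2) * ((q + 2) * (κ + 1) * ((m₀ + 1) * (t + 1))) : ℕ) : ℝ) ≤ n := by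
          rw [← mul_assoc, Nat.cast_mul]
          calc _ ≤ ((16 * (q + 2) * ((q + 2) * (κ + 1)) : ℕ) : ℝ) * v := by gcongr
            _ = ((16 * ((q + 2) * (q + 2) * (κ + 1)) : ℕ) : ℝ) * v := by push_cast; ring
            _ ≤ n := h
        exact le_trans (Nat.mul_le_mul_left _ h1) (by exact_mod_cast h3)
      have h3 : 16 * (q + 2) * g ≤ n := hgdef ▸ Nat.mul_div_le n _
      have h4 := Nat.lt_mul_div_succ n (show 0 < 4 * (q + 2) by omega)
      have h5 : 16 * (q + 2) ≤ n := (Nat.le_mul_of_pos_right _ (by omega)).trans h2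
      linarith
    · have := hkg' κ (by omega)
      have h2 : (κ : ℝ) ≤ κ * v := le_mul_of_one_le_right (by positivity) h1v
      exact_mod_cast h2.trans this
    · have := hkg' (2 * κ) (by omega)
      push_cast at this
      have h2 : 2 * κ * (b : ℝ) ≤ 2 * κ * v := by gcongr
      have h3 : ((2 * b * κ : ℕ) : ℝ) ≤ g := by push_cast; linarith
      exact_mod_cast h3
    · have := hkg' (2 * κ) (by omega)
      push_cast at this
      linarith
    · have := mul_le_mul_of_nonneg_right (hkg' (4 * ((1 + κ) * κ)) (by omega)) hp0
      rw [mul_assoc, ← hu] at this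
      push_cast at this
      have h2 : 4 * ((u + κ) * κ) ≤ 4 * ((u + κ * u) * κ) := by
        have : (κ : ℝ) ≤ κ * u := le_mul_of_one_le_right (by positivity) h1u
        gcongr
      linarith
  refine hasKrFactorOn_univ_of_props (δ := n * p / 2) (K := K) (m := m) (m₀ := m₀) (t := τ)
    hS hD hb hC hReach rfl hp0 (hn ▸ hr) hdeg ?_ (by omega) ?_ hτ ?_ ?_ ?_ ?_ ?_ hK.ge ?_ ?_ ?_ ?_
  · have h := hcu _ hΘ₁
    have h2 : (q : ℝ) * b ≤ q * u := by gcongr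
    push_cast at h
    linarith
  · have := hkm' 2 (by omega)
    push_cast at this
    have h2 : ((2 : ℕ) : ℝ) ≤ m := by push_cast; linarith
    exact_mod_cast h2
  · have : m ≤ n := hmdef ▸ Nat.div_le_self _ _
    omega
  · have := hkm' 2 (by omega)
    have h2 : ((2 * b : ℕ) : ℝ) ≤ m := by push_cast at this ⊢; linarith
    exact_mod_cast h2
  · have := hkm' 2 (by omega)
    push_cast at this
    exact this
  · rw [← hn]
    linarith
  · rw [Nat.le_div_iff_mul_le (by norm_num)]
    have h := hcv _ hΘ₃
    have h2 : (q : ℝ) * b ≤ q * v := by gcongr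
    have h3 : (M : ℝ) * m ≤ n := by exact_mod_cast hMm
    have h4 : (0 : ℝ) ≤ m := by positivity
    rw [hM] at h3
    have h5 : (((2 * b * (q + 1) + 5 * m + q * (3 + 140 * C) * m + K) * 2 : ℕ) : ℝ) ≤ n := by
      have : (0 : ℝ) ≤ q * (3 + 140 * C) * m := by positivity
      push_cast at h h3 ⊢
      linarith
    exact_mod_cast h5
  · have h1 : q * (τ + 20) ≤ K := by
      rw [hK]
      nlinarith [Nat.zero_le ((τ + 20) * C)]
    have h2 : ((q * (τ + 20) : ℕ) : ℝ) ≤ K := by exact_mod_cast h1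
    push_cast at h2
    linarith [(Nat.cast_nonneg κ : (0 : ℝ) ≤ κ)]
  · have h := hkm' (2 * (q * (q + 2)) + q) (by omega)
    have h2 : (q : ℝ) * b ≤ q * v := by gcongr
    have h3 : (q : ℝ) * ((q + 2) * m₀) ≤ q * ((q + 2) * v) := by gcongr
    have h4 : ((2 * (q * ((q + 1 + 1) * m₀)) + q * b : ℕ) : ℝ) ≤ m := by
      push_cast at h ⊢
      linarith
    exact_mod_cast h4
  · have h := hkm' (q + 2) (by have := Nat.zero_le (q * (q + 2)); omega)
    have h3 : (q + 2 : ℝ) * m₀ ≤ (q + 2) * v := by gcongr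
    have h4 : (((q + 1 + 1) * m₀ : ℕ) : ℝ) ≤ m := by
      push_cast at h ⊢
      linarith
    exact_mod_cast h4
  · have h := mul_le_mul_of_nonneg_right (hkm _ hΘ₅) hp0
    rw [mul_assoc, ← hu] at h
    have h2 : (q : ℝ) * b ≤ q * u := by gcongr
    have h3 : (q : ℝ) * ((τ + 20 : ℕ) : ℝ) ≤ q * u := by gcongr
    have h4 : (q : ℝ) * ((b * (τ + 20) : ℕ) : ℝ) ≤ q * u := by gcongr
    push_cast at h h3 h4 ⊢
    linarith

end Final

theorem statement_8 :
    ∀ r : ℕ, 4 ≤ r → ∀ β : ℝ, 0 < β →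
      ∃ α : ℝ, 0 < α ∧ ∃ n₀ : ℕ,
        ∀ n : ℕ, n₀ < n → r ∣ n →
          ∀ p : ℝ, (n : ℝ) ^ (-(1 : ℝ) / 3) ≤ p → p ≤ 1 →
            ∀ G : SimpleGraph (Fin n), Neat G α β p r →
              HasKrFactorOn G r Finset.univ := by
  intro r hr4 β hβ
  obtain ⟨q, rfl⟩ : ∃ q, r = q + 1 := ⟨r - 1, by omega⟩
  obtain ⟨γ, hγ⟩ : ∃ γ : ℝ, γ = min β 1 := ⟨_, rfl⟩
  have hγ0 : 0 < γ := hγ ▸ lt_min hβ one_pos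
  have hγ1 : γ ≤ 1 := hγ ▸ min_le_right _ _
  have hγβ : γ ≤ β := hγ ▸ min_le_left _ _
  obtain ⟨C, κ, -, hreach⟩ := exists_reachProp_constants q ⌈2 / γ⌉₊
  have hΘ : (0 : ℝ) < scaleConst q C κ := by
    have : 0 < scaleConst q C κ := by unfold scaleConst; omega
    exact_mod_cast this
  have hη : (0 : ℝ) < (scaleConst q C κ : ℝ)⁻¹ := inv_pos.2 hΘ
  obtain ⟨n₀, hn₀⟩ := Filter.eventually_atTop.1
    ((eventually_ceil_mul_log_le hη).and (eventually_ceil_rpow_mul_le hη hγ0 hγ1))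
  refine ⟨_, hη, n₀, fun n hn hr p hp hp1 G hG => ?_⟩
  obtain ⟨h1, h2⟩ := hn₀ n hn.le
  obtain ⟨hb, hB⟩ := h1 p hp
  obtain ⟨⟨hG1, hG2⟩, hG3, hG4⟩ := hG
  have hn1 : (1 : ℝ) ≤ n := by exact_mod_cast (by omega : 1 ≤ n)
  have hp0 : 0 ≤ p := le_trans (by positivity) hp
  refine hasKrFactorOn_univ_of_scale (b := ⌈Real.log n / p⌉₊) (τ := Nat.log 2 (6 * n) + 240)
    (m₀ := ⌈(n : ℝ) ^ (1 - γ)⌉₊) (t := ⌈(n : ℝ) ^ (γ / 2)⌉₊) (p := p) (hreach G)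
    (hG4.switchProp (le_trans ?_ (Nat.le_ceil _))) ?_ ?_ ?_ (Nat.ceil_pos.2 hb) hp0 hp1 ?_
    (by omega) ?_ ?_ ?_ ?_ ?_ hη (inv_mul_cancel₀ hΘ.ne')
  · exact Real.rpow_le_rpow_of_exponent_le hn1 (by linarith)
  · intro X Y hXY hX hY
    rw [Fintype.card_fin] at hY
    exact hG2 X Y hXY ((Nat.le_ceil _).trans (by exact_mod_cast hX)) hY
  · intro v X hX hXe
    rw [Fintype.card_fin] at hXe
    exact hG3 v X (fun x hx => (G.mem_neighborFinset v x).2 (hX x hx)) hXe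
  · intro v
    rw [Fintype.card_fin]
    refine (hG1 v).trans_eq ?_
    congr 2
    ext x
    simp
  · rwa [Fintype.card_fin]
  · rw [Fintype.card_fin]
    refine (Nat.lt_pow_succ_log_self one_lt_two _).le.trans (Nat.pow_le_pow_right two_pos ?_)
    omega
  · exact Nat.ceil_pos.2 (by positivity)
  · rw [Fintype.card_fin]
    exact hB
  · rw [Fintype.card_fin]
    exact h2
  · rw [Fintype.card_fin]
    have h : (n : ℝ) ≤ ((⌈(n : ℝ) ^ (γ / 2)⌉₊ ^ ⌈2 / γ⌉₊ : ℕ) : ℝ) := by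
      push_cast
      calc (n : ℝ) = n ^ (γ / 2 * (2 / γ)) := by
            rw [show γ / 2 * (2 / γ) = 1 by field_simp, Real.rpow_one]
        _ ≤ n ^ (γ / 2 * ⌈2 / γ⌉₊) := by
            refine Real.rpow_le_rpow_of_exponent_le hn1 ?_
            gcongr
            exact Nat.le_ceil _
        _ = ((n : ℝ) ^ (γ / 2)) ^ ⌈2 / γ⌉₊ := Real.rpow_mul_natCast (by positivity) _ _
        _ ≤ _ := by
            gcongr
            exact Nat.le_ceil _
    exact_mod_cast h
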